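/- arXiv:1707.00215 — 3 statements merged into one kernel-verified Lean document; each statement's English description precedes it below -/
import Mathlib

section
/- Let A be a bireversible automaton and let D_A = π₁(Δ_A) *_{⟨S⟩} π₁(Δ_A) be the double of π₁(Δ_A) along the subgroup ⟨S⟩, i.e. the amalgamated free product (pushout over the index type Bool) of two copies of the inclusion homomorphism ⟨S⟩ → π₁(Δ_A). Then D_A is residually finite if and only if the automaton group G_A is finite. -/
/-- A Mealy automaton with state set `S` and alphabet `X`:
`λ(s,x) = (o s x, t s x)`. -/
structure Mealy (S X : Type) where
  o : S → X → X
  t : S → X → S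

namespace Mealy

variable {S X : Type}

/-- Bireversibility of a Mealy automaton. -/
def Bireversible (M : Mealy S X) : Prop :=
  (∀ s, Function.Bijective (M.o s)) ∧
  (∀ x, Function.Bijective (fun s => M.t s x)) ∧
  Function.Bijective (fun p : S × X => (M.o p.1 p.2, M.t p.1 p.2))

/-- The action of a state on words over the alphabet. -/
def actWord (M : Mealy S X) : S → List X → List X
  | _, [] => []
  | s, x :: w => M.o s x :: M.actWord (M.t s x) w

/-- The dual action of a letter on words over the states. -/
def dualActWord (M : Mealy S X) : X → List S → List S
  | _, [] => []
  | x, s :: w => M.t s x :: M.dualActWord (M.o s x) w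

/-- The relators `s x (t s x)⁻¹ (o s x)⁻¹` of the square-complex group. -/
def rels (M : Mealy S X) : Set (FreeGroup (S ⊕ X)) :=
  ⋃ (s : S) (x : X),
    {FreeGroup.of (Sum.inl s) * FreeGroup.of (Sum.inr x) *
      (FreeGroup.of (Sum.inl (M.t s x)))⁻¹ * (FreeGroup.of (Sum.inr (M.o s x)))⁻¹}

/-- The fundamental group `π₁(Δ_A)` of the square complex of the automaton. -/
abbrev Pi1 (M : Mealy S X) := PresentedGroup M.rels

/-- The image of a state in `π₁(Δ_A)`. -/
def genS (M : Mealy S X) (s : S) : M.Pi1 := PresentedGroup.of (Sum.inl s)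

/-- The image of a letter in `π₁(Δ_A)`. -/
def genX (M : Mealy S X) (x : X) : M.Pi1 := PresentedGroup.of (Sum.inr x)

/-- The subgroup `⟨S⟩` of `π₁(Δ_A)`. -/
def subS (M : Mealy S X) : Subgroup M.Pi1 := Subgroup.closure (Set.range M.genS)

/-- The subgroup `⟨X⟩` of `π₁(Δ_A)`. -/
def subX (M : Mealy S X) : Subgroup M.Pi1 := Subgroup.closure (Set.range M.genX)

/-- The automaton group `G_A`: the subgroup of `Perm (List X)` generated by the
permutations `σ_s` defined by the states. -/
def autGroup (M : Mealy S X) : Subgroup (Equiv.Perm (List X)) :=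
  Subgroup.closure {σ : Equiv.Perm (List X) | ∃ s, ⇑σ = M.actWord s}

/-- The dual automaton group `G_{∂A}`. -/
def dualAutGroup (M : Mealy S X) : Subgroup (Equiv.Perm (List S)) :=
  Subgroup.closure {τ : Equiv.Perm (List S) | ∃ x, ⇑τ = M.dualActWord x}

end Mealy

theorem Subgroup.FiniteIndex.comap {G G' : Type*} [Group G] [Group G'] (H : Subgroup G')
    [H.FiniteIndex] (f : G →* G') : (H.comap f).FiniteIndex :=
  ⟨by
    rw [Subgroup.index_comap]
    exact (Subgroup.isFiniteRelIndex_of_finiteIndex).relIndex_ne_zero⟩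

open Group in
/-- A group with a residually finite subgroup of finite index is residually finite. -/
theorem residuallyFinite_of_finiteIndex {G : Type*} [Group G] (W : Subgroup G) [W.FiniteIndex]
    [ResiduallyFinite W] : ResiduallyFinite G := by
  rw [residuallyFinite_iff_exists_finiteIndex]
  intro g hg
  by_cases hgW : g ∈ W
  · obtain ⟨K, hK, hgK⟩ := residuallyFinite_iff_exists_finiteIndex.mp ‹ResiduallyFinite W›
      ⟨g, hgW⟩ (by simpa [Subtype.ext_iff] using hg)
    refine ⟨K.map W.subtype, ⟨?_⟩, ?_⟩
    · rw [Subgroup.index_map_subtype]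
      exact mul_ne_zero hK.index_ne_zero Subgroup.FiniteIndex.index_ne_zero
    · rintro ⟨⟨k, hk⟩, hkK, rfl⟩
      exact hgK hkK
  · exact ⟨W, inferInstance, hgW⟩

open Group in
theorem residuallyFinite_of_injective {G G' : Type*} [Group G] [Group G'] [ResiduallyFinite G']
    (f : G →* G') (hf : Function.Injective f) : ResiduallyFinite G := by
  rw [residuallyFinite_iff_forall_finiteIndex]
  intro g hg
  apply hf
  rw [map_one]
  exact residuallyFinite_iff_forall_finiteIndex.mp ‹_› _ fun H _ ↦
    have := Subgroup.FiniteIndex.comap H f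
    hg (H.comap f)

open Group in
/-- Finite subgroups of residually finite groups are separable. -/
theorem exists_finiteIndex_ge_notMem {G : Type*} [Group G] [ResiduallyFinite G] (P : Subgroup G)
    [Finite P] {g : G} (hg : g ∉ P) : ∃ E : Subgroup G, E.FiniteIndex ∧ P ≤ E ∧ g ∉ E := by
  have hne (p : P) : (p : G)⁻¹ * g ≠ 1 := fun h ↦ hg (inv_mul_eq_one.mp h ▸ p.2)
  choose N hN using fun p ↦ exists_finiteIndexNormalSubgroup_notMem _ (hne p)
  let N' : Subgroup G := ⨅ p, (N p).toSubgroup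
  have : N'.FiniteIndex := Subgroup.finiteIndex_iInf fun p ↦ inferInstance
  have : N'.Normal := Subgroup.normal_iInf_normal fun p ↦ inferInstance
  refine ⟨P ⊔ N', Subgroup.finiteIndex_of_le le_sup_right, le_sup_left, fun h ↦ ?_⟩
  obtain ⟨p, hp, n, hn, rfl⟩ := Subgroup.mem_sup_of_normal_right.mp h
  refine hN ⟨p, hp⟩ ?_
  rw [inv_mul_cancel_left]
  exact Subgroup.mem_iInf.mp hn ⟨p, hp⟩

/-- A partial injection of a finite type extends to a permutation. -/
theorem exists_perm_extending {α : Type*} [Finite α] (R : α → α → Prop)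
    (hfun : ∀ x y z, R x y → R x z → y = z) (hinj : ∀ x y z, R x z → R y z → x = y) :
    ∃ σ : Equiv.Perm α, ∀ x y, R x y → σ x = y := by
  classical
  have := Fintype.ofFinite α
  choose f hf using fun x : {x // ∃ y, R x y} ↦ x.2
  let e : {x // ∃ y, R x y} ≃ {y // ∃ x, R x y} :=
    Equiv.ofBijective (fun x ↦ ⟨f x, x, hf x⟩)
      ⟨fun x y h ↦ Subtype.ext (hinj _ _ (f x) (hf x) (by
        have : f x = f y := congrArg Subtype.val h
        exact this ▸ hf y)),
       fun ⟨y, x, hxy⟩ ↦ ⟨⟨x, y, hxy⟩, Subtype.ext (hfun x _ _ (hf ⟨x, y, hxy⟩) hxy)⟩⟩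
  refine ⟨e.extendSubtype, fun x y h ↦ ?_⟩
  rw [Equiv.extendSubtype_apply_of_mem e x ⟨y, h⟩]
  exact hfun x _ _ (hf ⟨x, y, h⟩) h

/-- Free groups are residually finite. -/
instance FreeGroup.residuallyFinite {α : Type*} : Group.ResiduallyFinite (FreeGroup α) := by
  classical
  apply Group.residuallyFinite_of_forall_exists_finite_monoidHom
  intro w hw
  set L := w.toWord with hL
  set n := L.length with hn
  let R (a : α) (i j : Fin (n + 1)) : Prop :=
    (j.val = i.val + 1 ∧ L.reverse[i.val]? = some (a, true)) ∨
    (i.val = j.val + 1 ∧ L.reverse[j.val]? = some (a, false))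
  have hred : ∀ (i : ℕ) a b, L.reverse[i]? = some (a, b) →
      L.reverse[i + 1]? = some (a, !b) → False := by
    intro i a b h1 h2
    have hr : FreeGroup.IsReduced L := FreeGroup.isReduced_toWord
    have hr' := List.isChain_reverse.mpr hr
    rw [List.isChain_iff_getElem] at hr'
    obtain ⟨h1', h1⟩ := List.getElem?_eq_some_iff.mp h1
    obtain ⟨h2', h2⟩ := List.getElem?_eq_some_iff.mp h2
    have := hr' i h2'
    rw [h1, h2] at this
    cases b <;> simp at this
  have hσ (a : α) : ∃ σ : Equiv.Perm (Fin (n + 1)), ∀ x y, R a x y → σ x = y := by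
    apply exists_perm_extending
    · rintro x y z (⟨h1, h1'⟩ | ⟨h1, h1'⟩) (⟨h2, h2'⟩ | ⟨h2, h2'⟩)
      · ext; omega
      · rw [h2] at h1'; exact (hred _ _ _ h2' h1').elim
      · rw [h1] at h2'; exact (hred _ _ _ h1' h2').elim
      · ext; omega
    · rintro x y z (⟨h1, h1'⟩ | ⟨h1, h1'⟩) (⟨h2, h2'⟩ | ⟨h2, h2'⟩)
      · ext; omega
      · rw [h1] at h2'; exact (hred _ _ _ h1' h2').elim
      · rw [h2] at h1'; exact (hred _ _ _ h2' h1').elim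
      · ext; omega
  choose σ hσ using hσ
  refine ⟨Equiv.Perm (Fin (n + 1)), inferInstance, inferInstance, FreeGroup.lift σ, ?_⟩
  have key : ∀ l, l <:+ L → ∀ h : l.length < n + 1,
      FreeGroup.lift σ (FreeGroup.mk l) 0 = ⟨l.length, h⟩ := by
    intro l
    induction l with
    | nil => intro _ _; rw [← FreeGroup.one_eq_mk]; simp
    | cons a l ih =>
      intro hs h
      have hs' : l <:+ L := (List.suffix_cons a l).trans hs
      have hget : L.reverse[l.length]? = some a := by
        obtain ⟨p, hp⟩ := hs
        rw [← hp]; simp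
      have hl : l.length < n + 1 := by simp at h; omega
      have e : FreeGroup.mk (a :: l) = FreeGroup.mk [a] * FreeGroup.mk l := by simp
      rw [e, MonoidHom.map_mul, Equiv.Perm.mul_apply, ih hs' hl]
      obtain ⟨a, b⟩ := a
      cases b
      · have : σ a ⟨l.length + 1, h⟩ = ⟨l.length, hl⟩ := hσ a _ _ (Or.inr ⟨rfl, hget⟩)
        simp only [FreeGroup.lift_mk, List.map_cons, List.map_nil, List.prod_singleton, cond_false]
        rw [Equiv.Perm.inv_eq_iff_eq]; exact this.symm
      · simpa using hσ a _ _ (Or.inl ⟨rfl, hget⟩)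
  intro h1
  have := key L List.suffix_rfl (by omega)
  rw [show FreeGroup.mk L = w from FreeGroup.mk_toWord, h1] at this
  have hn0 : n = 0 := by
    have := congrArg (fun z ↦ z.val) this
    rw [hn]; simpa using this.symm
  exact hw (FreeGroup.toWord_eq_nil_iff.mp (List.length_eq_zero_iff.mp hn0))

section Double

open Classical in
/-- For `c 0, …, c (n - 1) ∉ P`, the involution of `Q × Fin (n + 1)` that commutes with left
multiplication by `P` and exchanges `(c i, i)` with `(1, i + 1)`. -/
noncomputable def levelSwap {Q : Type*} [Group Q] (P : Subgroup Q) (c : ℕ → Q) (n : ℕ)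
    (z : Q × Fin (n + 1)) : Q × Fin (n + 1) :=
  if z.1 ∈ P then
    if z.2.val = 0 then z else (z.1 * c (z.2.val - 1), ⟨z.2.val - 1, by omega⟩)
  else if h : z.1 * (c z.2.val)⁻¹ ∈ P ∧ z.2.val < n then
    (z.1 * (c z.2.val)⁻¹, ⟨z.2.val + 1, by omega⟩)
  else z

variable {Q : Type*} [Group Q] {P : Subgroup Q} {c : ℕ → Q} {n : ℕ}

theorem levelSwap_one_zero : levelSwap P c n (1, 0) = (1, 0) := by
  simp [levelSwap, P.one_mem]

theorem levelSwap_apply_self (hc : ∀ i < n, c i ∉ P) (i : ℕ) (hi : i < n) :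
    levelSwap P c n (c i, ⟨i, by omega⟩) = (1, ⟨i + 1, by omega⟩) := by
  simp [levelSwap, hc i hi, hi, P.one_mem]

theorem levelSwap_involutive (hc : ∀ i < n, c i ∉ P) :
    Function.Involutive (levelSwap P c n) := by
  rintro ⟨q, i, hi⟩
  by_cases hq : q ∈ P
  · rcases i with _ | i
    · simp [levelSwap, hq]
    · have h : q * c i ∉ P := by
        rw [P.mul_mem_cancel_left hq]
        exact hc i (by omega)
      simp [levelSwap, hq, h, show i < n by omega]
  · by_cases h : q * (c i)⁻¹ ∈ P ∧ i < n
    · simp [levelSwap, hq, h]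
    · simp [levelSwap, hq, h]

theorem levelSwap_mul {p : Q} (hp : p ∈ P) (q : Q) (i : Fin (n + 1)) :
    levelSwap P c n (p * q, i) =
      (p * (levelSwap P c n (q, i)).1, (levelSwap P c n (q, i)).2) := by
  have h1 : p * q ∈ P ↔ q ∈ P := P.mul_mem_cancel_left hp
  have h2 : p * q * (c i)⁻¹ ∈ P ↔ q * (c i)⁻¹ ∈ P := by
    rw [mul_assoc, P.mul_mem_cancel_left hp]
  by_cases hq : q ∈ P
  · by_cases hi : i.val = 0 <;> simp only [levelSwap, h1, hq, hi, if_true, if_false, mul_assoc]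
  · by_cases hi : q * (c i)⁻¹ ∈ P ∧ i.val < n
    · have hi' := h2.mpr hi.1
      simp only [levelSwap, h1, hq, hi, hi', if_false, and_self, dite_true]
      exact Prod.ext (mul_assoc _ _ _) rfl
    · simp only [levelSwap, h1, h2, hq, hi, if_false, dite_false]

/-- Left multiplication on the first coordinate. -/
def mulLeftFst (Q F : Type*) [Group Q] : Q →* Equiv.Perm (Q × F) where
  toFun q := (Equiv.mulLeft q).prodCongr (Equiv.refl F)
  map_one' := by ext <;> simp
  map_mul' a b := by ext <;> simp [mul_assoc]

@[simp]
theorem mulLeftFst_apply (F : Type*) (q : Q) (z : Q × F) :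
    mulLeftFst Q F q z = (q * z.1, z.2) := rfl

variable {G : Type*} [Group G] {H : Subgroup G}

open Monoid

/-- An alternating product of elements outside the amalgamated subgroup acts nontrivially on some
finite set, as soon as the letters are separated from the amalgamated subgroup in a finite
quotient. -/
theorem exists_perm_of_alternating [Finite Q] (f : G →* Q) (hf : H.map f ≤ P) (h : H)
    (l : List (Bool × G)) (hl : l ≠ []) (halt : l.IsChain fun a b ↦ a.1 ≠ b.1)
    (hlP : ∀ a ∈ l, f a.2 ∉ P) :
    ∃ (m : ℕ) (Ψ : PushoutI (fun _ : Bool ↦ H.subtype) →* Equiv.Perm (Q × Fin m)),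
      Ψ (PushoutI.base _ h * (l.map fun a ↦ PushoutI.of (φ := fun _ : Bool ↦ H.subtype)
        a.1 a.2).prod) ≠ 1 := by
  obtain ⟨c, hc⟩ : ∃ c : ℕ → Q, ∀ a m, a :: m <:+ l → c m.length = f a.2 := by
    refine ⟨fun i ↦ (l.reverse.map fun a ↦ f a.2).getD i 1, fun a m ⟨p, hp⟩ ↦ ?_⟩
    simp [← hp]
  obtain ⟨n, hn⟩ : ∃ n, l.length = n + 1 :=
    Nat.exists_eq_succ_of_ne_zero (by simpa using hl)
  have hcP : ∀ i < n + 1, c i ∉ P := by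
    intro i hi
    have hi' : n - i < l.length := by omega
    have hs := List.drop_suffix (n - i) l
    rw [List.drop_eq_getElem_cons hi'] at hs
    have := hc _ _ hs
    rw [List.length_drop, show l.length - (n - i + 1) = i by omega] at this
    rw [this]
    exact hlP _ (List.getElem_mem _)
  have hcn : ∀ i < n, c i ∉ P := fun i hi ↦ hcP i (by omega)
  let τ : Equiv.Perm (Q × Fin (n + 1)) := (levelSwap_involutive hcn).toPerm
  have hτ : ∀ z, τ z = levelSwap P c n z := fun z ↦ rfl
  have hττ : τ * τ = 1 := Equiv.ext fun z ↦ levelSwap_involutive hcn z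
  have hτi : τ⁻¹ = τ := inv_eq_of_mul_eq_one_left hττ
  let b₀ : Bool := (l.getLast hl).1
  let σ (b : Bool) : Equiv.Perm (Q × Fin (n + 1)) := if b = b₀ then 1 else τ
  have hσσ (b : Bool) : σ b * σ b = 1 := by
    by_cases hb : b = b₀ <;> simp [σ, hb, hττ]
  have hσne (b b' : Bool) (hb : b ≠ b') : σ b * σ b' = τ := by
    by_cases h1 : b = b₀ <;> by_cases h2 : b' = b₀
    · exact absurd (h1.trans h2.symm) hb
    · simp [σ, h1, h2]
    · simp [σ, h1, h2]
    · cases b <;> cases b' <;> cases hb₀ : b₀ <;> simp_all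
  have hσi (b : Bool) : (σ b)⁻¹ = σ b := inv_eq_of_mul_eq_one_left (hσσ b)
  have hcomm (b : Bool) (g : H) (z) :
      σ b (mulLeftFst Q (Fin (n + 1)) (f g) z) = mulLeftFst Q (Fin (n + 1)) (f g) (σ b z) := by
    by_cases hb : b = b₀
    · simp [σ, hb]
    · simp only [σ, hb, if_false, hτ, mulLeftFst_apply]
      exact levelSwap_mul (hf ⟨g, g.2, rfl⟩) _ _
  let Ψ : PushoutI (fun _ : Bool ↦ H.subtype) →* Equiv.Perm (Q × Fin (n + 1)) :=
    PushoutI.lift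
      (fun b ↦ (MulAut.conj (σ b)).toMonoidHom.comp ((mulLeftFst Q (Fin (n + 1))).comp f))
      ((mulLeftFst Q (Fin (n + 1))).comp (f.comp H.subtype)) (fun b ↦ by
        ext1 g
        ext1 z
        have := hcomm b g (σ b z)
        simp only [← Equiv.Perm.mul_apply (σ b) (σ b), hσσ] at this
        simpa [hσi] using this)
  have hΨ (b : Bool) (g : G) (z) : Ψ (PushoutI.of b g) z =
      σ b (mulLeftFst Q (Fin (n + 1)) (f g) (σ b z)) := by
    simp only [Ψ, PushoutI.lift_of, MonoidHom.comp_apply, MulEquiv.coe_toMonoidHom,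
      MulAut.conj_apply, hσi, Equiv.Perm.mul_apply]
  have key : ∀ m a, a :: m <:+ l → ∀ hm : m.length < n + 1,
      Ψ ((a :: m).map fun a ↦ PushoutI.of a.1 a.2).prod (1, 0) =
        σ a.1 (f a.2, ⟨m.length, hm⟩) := by
    intro m
    induction m with
    | nil =>
      rintro a ⟨p, hp⟩ _
      have ha : a.1 = b₀ := by simp [b₀, ← hp]
      have hσ : σ a.1 = 1 := if_pos ha
      simp only [List.map_cons, List.map_nil, List.prod_singleton]
      simp [hΨ, hσ]
    | cons a' m ih =>
      intro a hs hm
      have hs' := (List.suffix_cons a (a' :: m)).trans hs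
      have hm' : m.length < n := by simpa using hm
      have hne : a.1 ≠ a'.1 := (List.isChain_cons_cons.mp (halt.suffix hs)).1
      rw [List.map_cons, List.prod_cons, MonoidHom.map_mul, Equiv.Perm.mul_apply,
        ih a' hs' (by omega), hΨ, ← Equiv.Perm.mul_apply (σ a.1) (σ a'.1), hσne _ _ hne, hτ,
        ← hc _ _ hs', levelSwap_apply_self hcn _ hm']
      simp
  obtain ⟨a, m, rfl⟩ := List.exists_cons_of_ne_nil hl
  have hm : m.length = n := by simpa using hn
  refine ⟨n + 1, Ψ, fun h1 ↦ ?_⟩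
  have h2 := congrArg (fun e : Equiv.Perm _ ↦ e ((1 : Q), (0 : Fin (n + 1)))) h1
  simp only [MonoidHom.map_mul, Equiv.Perm.mul_apply, Equiv.Perm.one_apply] at h2
  rw [key m a List.suffix_rfl (by omega)] at h2
  have hb : Ψ (PushoutI.base _ h) = mulLeftFst Q (Fin (n + 1)) (f h) := by
    simp [Ψ, PushoutI.lift_base]
  rw [hb, ← hcomm] at h2
  have h3 := congrArg (σ a.1) h2
  rw [← Equiv.Perm.mul_apply, hσσ, Equiv.Perm.one_apply] at h3
  have h4 : σ a.1 (1, 0) = (1, 0) := by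
    by_cases hb : a.1 = b₀
    · simp [σ, hb]
    · simp only [σ, hb, if_false, hτ]
      exact levelSwap_one_zero
  rw [h4] at h3
  have h5 : f h * f a.2 = 1 := congrArg Prod.fst h3
  refine hlP a (by simp) ?_
  rw [eq_inv_of_mul_eq_one_right h5]
  exact P.inv_mem (hf ⟨h, h.2, rfl⟩)

theorem PushoutI.exists_alternating (d : PushoutI (fun _ : Bool ↦ H.subtype)) :
    ∃ (h : H) (l : List (Bool × G)), (l.IsChain fun a b ↦ a.1 ≠ b.1) ∧ (∀ a ∈ l, a.2 ∉ H) ∧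
      d = PushoutI.base _ h * (l.map fun a ↦ PushoutI.of (φ := fun _ : Bool ↦ H.subtype)
        a.1 a.2).prod := by
  classical
  obtain ⟨t⟩ := PushoutI.NormalWord.transversal_nonempty (fun _ : Bool ↦ H.subtype)
    fun _ ↦ H.subtype_injective
  obtain ⟨w, rfl⟩ := (PushoutI.NormalWord.equiv (d := t)).symm.surjective d
  refine ⟨w.head, w.toList.map fun a ↦ (a.1, a.2), ?_, ?_, ?_⟩
  · rw [List.isChain_map]
    exact w.chain_ne
  · intro a ha
    obtain ⟨⟨b, g⟩, hg, rfl⟩ := List.mem_map.mp ha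
    intro hgH
    have hg1 : g ≠ 1 := w.ne_one _ hg
    have hgt := w.normalized _ _ hg
    have := (t.compl b).1 (a₁ := (⟨1, one_mem _⟩, ⟨g, hgt⟩))
      (a₂ := (⟨g, by simpa using hgH⟩, ⟨1, t.one_mem b⟩)) (by simp)
    exact hg1 (by simpa using (congrArg (fun z ↦ (z.2 : G)) this))
  · change PushoutI.NormalWord.prod w = _
    rw [PushoutI.NormalWord.prod, CoprodI.Word.prod, map_list_prod]
    simp [Function.comp_def]

/-- The double of a residually finite group along a separable subgroup is residually finite. -/
theorem residuallyFinite_double [Group.ResiduallyFinite G]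
    (hH : ∀ g ∉ H, ∃ E : Subgroup G, E.FiniteIndex ∧ H ≤ E ∧ g ∉ E) :
    Group.ResiduallyFinite (PushoutI (fun _ : Bool ↦ H.subtype)) := by
  rw [Group.residuallyFinite_iff_exists_finiteIndex]
  intro d hd
  obtain ⟨h, l, halt, hlH, rfl⟩ := PushoutI.exists_alternating d
  rcases eq_or_ne l [] with rfl | hl
  · let fold : PushoutI (fun _ : Bool ↦ H.subtype) →* G :=
      PushoutI.lift (fun _ ↦ MonoidHom.id G) H.subtype fun _ ↦ rfl
    obtain ⟨N, hN, hhN⟩ := Group.residuallyFinite_iff_exists_finiteIndex.mp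
      ‹Group.ResiduallyFinite G› h (fun h1 ↦ hd (by simp [Subtype.ext (a1 := h) (a2 := 1) h1]))
    refine ⟨N.comap fold, Subgroup.FiniteIndex.comap N fold, ?_⟩
    simpa [fold] using hhN
  · choose! E hE hHE hgE using hH
    have : Finite {a // a ∈ l} := l.finite_toSet.to_subtype
    let N : Subgroup G := ⨅ a : {a // a ∈ l}, (E a.1.2).normalCore
    have : N.FiniteIndex := Subgroup.finiteIndex_iInf fun a ↦
      have := hE _ (hlH _ a.2)
      inferInstance
    have : N.Normal := Subgroup.normal_iInf_normal fun a ↦ inferInstance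
    obtain ⟨m, Ψ, hΨ⟩ := exists_perm_of_alternating (QuotientGroup.mk' N) (H := H)
      (le_refl (H.map (QuotientGroup.mk' N))) h l hl halt (by
        rintro a ha ⟨g, hg, hga⟩
        refine hgE _ (hlH a ha) ?_
        have h1 : g⁻¹ * a.2 ∈ E a.2 := (E a.2).normalCore_le
          (Subgroup.mem_iInf.mp (QuotientGroup.eq.mp hga) ⟨a, ha⟩)
        simpa using (E a.2).mul_mem (hHE _ (hlH a ha) hg) h1)
    exact ⟨Ψ.ker, inferInstance, by simpa [MonoidHom.mem_ker] using hΨ⟩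

/-- If the double of a group along a subgroup is residually finite, the subgroup is separable. -/
theorem exists_finiteIndex_of_residuallyFinite_double
    [Group.ResiduallyFinite (PushoutI (fun _ : Bool ↦ H.subtype))] {g : G} (hg : g ∉ H) :
    ∃ E : Subgroup G, E.FiniteIndex ∧ H ≤ E ∧ g ∉ E := by
  let i (b : Bool) : G →* PushoutI (fun _ : Bool ↦ H.subtype) :=
    PushoutI.of (φ := fun _ : Bool ↦ H.subtype) b
  have hne : i true g ≠ i false g := by
    intro h
    have hr := PushoutI.inf_of_range_eq_base_range (φ := fun _ : Bool ↦ H.subtype)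
      (fun _ ↦ H.subtype_injective) (i := true) (j := false) (by simp)
    have hmem : i true g ∈ (PushoutI.base fun _ : Bool ↦ H.subtype).range := by
      rw [← hr]
      exact ⟨⟨g, rfl⟩, ⟨g, h.symm⟩⟩
    obtain ⟨k, hk⟩ := hmem
    rw [← PushoutI.of_apply_eq_base (fun _ : Bool ↦ H.subtype) true] at hk
    have := PushoutI.of_injective (φ := fun _ : Bool ↦ H.subtype)
      (fun _ ↦ H.subtype_injective) true hk
    exact hg (this ▸ k.2)
  obtain ⟨N, hN⟩ := Group.exists_finiteIndexNormalSubgroup_of_residuallyFinite _ _ hne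
  let p (b : Bool) := (QuotientGroup.mk' N.toSubgroup).comp (i b)
  refine ⟨(p true).eqLocus (p false), ?_, fun k hk ↦ ?_, hN⟩
  · have : ((p true).ker ⊓ (p false).ker).FiniteIndex := inferInstance
    refine Subgroup.finiteIndex_of_le (H := (p true).ker ⊓ (p false).ker) fun k hk ↦ ?_
    exact (MonoidHom.mem_ker.mp hk.1).trans (MonoidHom.mem_ker.mp hk.2).symm
  · have (b : Bool) : i b k = PushoutI.base _ ⟨k, hk⟩ :=
      PushoutI.of_apply_eq_base (fun _ : Bool ↦ H.subtype) b ⟨k, hk⟩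
    change p true k = p false k
    simp [p, this]

end Double

section Factorization

open Group

theorem residuallyFinite_range {G G' : Type*} [Group G] [Group G'] [ResiduallyFinite G]
    (f : G →* G') (hf : Function.Injective f) : ResiduallyFinite f.range :=
  residuallyFinite_of_injective (MonoidHom.ofInjective hf).symm.toMonoidHom
    (MonoidHom.ofInjective hf).symm.injective

variable {G : Type*} [Group G] {A B : Subgroup G}

/-- A finitely generated subgroup whose generators have finite `B`-conjugacy orbits is centralized
by a subgroup of finite index of `B`. -/
theorem exists_finiteIndex_commute {F : Set G} (hF : F.Finite)
    (hT : ∀ r ∈ F, ∃ T : Set G, T.Finite ∧ r ∈ T ∧ ∀ b ∈ B, ∀ t ∈ T, b * t * b⁻¹ ∈ T) :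
    ∃ L : Subgroup B, L.FiniteIndex ∧
      ∀ r ∈ Subgroup.closure F, ∀ l ∈ L, Commute r (l : G) := by
  let _ : MulAction B G := MulAction.compHom G (MulAut.conj.comp B.subtype)
  have hsmul (b : B) (g : G) : b • g = b * g * (b : G)⁻¹ := rfl
  have := hF.to_subtype
  refine ⟨⨅ r : F, MulAction.stabilizer B (r : G), Subgroup.finiteIndex_iInf ?_, ?_⟩
  · rintro ⟨r, hr⟩
    obtain ⟨T, hTf, hrT, hT⟩ := hT r hr
    refine ⟨?_⟩
    rw [MulAction.index_stabilizer]
    have hsub : MulAction.orbit B r ⊆ T := by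
      rintro _ ⟨b, rfl⟩
      exact hT b b.2 r hrT
    exact (Set.ncard_pos (hTf.subset hsub)).mpr ⟨r, MulAction.mem_orbit_self r⟩ |>.ne'
  · intro r hr l hl
    have h : Subgroup.closure F ≤ Subgroup.centralizer {(l : G)} := by
      rw [Subgroup.closure_le]
      intro f hf
      have h1 : l • f = f := Subgroup.mem_iInf.mp hl ⟨f, hf⟩
      rw [hsmul, mul_inv_eq_iff_eq_mul] at h1
      exact Subgroup.mem_centralizer_singleton_iff.mpr h1.symm
    exact Subgroup.mem_centralizer_singleton_iff.mp (h hr)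

/-- If `G = BA` with `A ∩ B` trivial, and `R` is a finite-index subgroup of `A`, normal in `G` and
commuting with a finite-index subgroup `L` of `B`, then `R × L` has finite index in `G`. -/
theorem finiteIndex_sup_map_subtype (hBA : ∀ g, ∃ b ∈ B, ∃ a ∈ A, g = b * a)
    (R : Subgroup A) [R.FiniteIndex] [(R.map A.subtype).Normal] (L : Subgroup B) [L.FiniteIndex] :
    (R.map A.subtype ⊔ L.map B.subtype).FiniteIndex := by
  set W := R.map A.subtype ⊔ L.map B.subtype
  let f (p : (A ⧸ R) × (B ⧸ L)) : G ⧸ W := ((p.1.out : G) * (p.2.out : G) : G)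
  have hf : Function.Surjective f := by
    intro q
    obtain ⟨g, rfl⟩ := QuotientGroup.mk_surjective q
    obtain ⟨b, hb, a, ha, hg⟩ := hBA g⁻¹
    obtain ⟨r, hr⟩ := QuotientGroup.mk_out_eq_mul R ⟨a⁻¹, A.inv_mem ha⟩
    obtain ⟨l, hl⟩ := QuotientGroup.mk_out_eq_mul L ⟨b⁻¹, B.inv_mem hb⟩
    refine ⟨(((⟨a⁻¹, A.inv_mem ha⟩ : A) : A ⧸ R), ((⟨b⁻¹, B.inv_mem hb⟩ : B) : B ⧸ L)), ?_⟩
    have hg' : g = a⁻¹ * b⁻¹ := by rw [← mul_inv_rev, ← hg, inv_inv]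
    simp only [f, hr, hl]
    rw [hg', QuotientGroup.eq]
    have h1 : ((r : A) : G)⁻¹ ∈ R.map A.subtype :=
      inv_mem ⟨r, r.2, rfl⟩
    have h2 : ((l : B) : G)⁻¹ ∈ L.map B.subtype := inv_mem ⟨l, l.2, rfl⟩
    have h3 := ‹(R.map A.subtype).Normal›.conj_mem _ h1 b
    have h4 : (((⟨a⁻¹, A.inv_mem ha⟩ * r : A) : G) * ((⟨b⁻¹, B.inv_mem hb⟩ * l : B) : G))⁻¹ *
        (a⁻¹ * b⁻¹) = ((l : B) : G)⁻¹ * (b * ((r : A) : G)⁻¹ * b⁻¹) := by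
      simp only [Subgroup.coe_mul]
      group
    rw [h4]
    exact mul_mem (le_sup_right (a := R.map A.subtype) h2) (le_sup_left (b := L.map B.subtype) h3)
  have := Finite.of_surjective f hf
  exact Subgroup.finiteIndex_of_finite_quotient

variable [ResiduallyFinite B]
    (hBA : ∀ g, ∃ b ∈ B, ∃ a ∈ A, g = b * a) (hAB : Disjoint A B)
    (R : Subgroup A) [R.FiniteIndex] [(R.map A.subtype).Normal] (L : Subgroup B) [L.FiniteIndex]

include hBA hAB R L in
theorem exists_finiteIndex_of_factorization {g : G} (hg : g ∉ A) :
    ∃ E : Subgroup G, E.FiniteIndex ∧ A ≤ E ∧ g ∉ E := by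
  set N := R.map A.subtype with hN
  have hNA : N ≤ A := Subgroup.map_subtype_le R
  let π := QuotientGroup.mk' N
  let f := π.comp (B.subtype.comp L.subtype)
  have hf : Function.Injective f := by
    rw [injective_iff_map_eq_one]
    intro l hl
    have h1 : ((l : B) : G) ∈ A := hNA ((QuotientGroup.eq_one_iff _).mp hl)
    have h2 := Subgroup.disjoint_def.mp hAB h1 (l : B).2
    exact Subtype.ext (Subtype.ext h2)
  have := residuallyFinite_range f hf
  have hfr : f.range = (L.map B.subtype).map π := by simp [f, MonoidHom.range_comp]
  have : f.range.FiniteIndex := by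
    refine ⟨?_⟩
    rw [hfr, Subgroup.index_map, QuotientGroup.ker_mk',
      MonoidHom.range_eq_top.mpr (QuotientGroup.mk'_surjective N), Subgroup.index_top, mul_one,
      sup_comm]
    exact (finiteIndex_sup_map_subtype hBA R L).index_ne_zero
  have : ResiduallyFinite (G ⧸ N) := residuallyFinite_of_finiteIndex f.range
  have hfin : Finite (A.map π) := by
    let k : A →* G ⧸ N := π.comp A.subtype
    have hk : R ≤ k.ker := fun r hr ↦ (QuotientGroup.eq_one_iff _).mpr ⟨r, hr, rfl⟩
    have : k.ker.FiniteIndex := Subgroup.finiteIndex_of_le hk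
    rw [show A.map π = k.range by simp [k, MonoidHom.range_comp]]
    exact Finite.of_equiv _ (QuotientGroup.quotientKerEquivRange k).toEquiv
  have hg' : π g ∉ A.map π := by
    rintro ⟨a, ha, hag⟩
    have h1 : a⁻¹ * g ∈ A := hNA (QuotientGroup.eq.mp hag)
    exact hg ((A.mul_mem_cancel_left (A.inv_mem ha)).mp h1)
  obtain ⟨E, hE, hAE, hgE⟩ := exists_finiteIndex_ge_notMem (A.map π) hg'
  exact ⟨E.comap π, Subgroup.FiniteIndex.comap E π, Subgroup.map_le_iff_le_comap.mp hAE, hgE⟩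

include hBA hAB in
theorem residuallyFinite_of_factorization [ResiduallyFinite A]
    (hRL : ∀ (r : R) (l : L), Commute ((r : A) : G) ((l : B) : G)) : ResiduallyFinite G := by
  let f := A.subtype.comp R.subtype
  let f' := B.subtype.comp L.subtype
  have hf : f.range = R.map A.subtype := by simp [f, MonoidHom.range_comp]
  have hf' : f'.range = L.map B.subtype := by simp [f', MonoidHom.range_comp]
  have hcomm (r : R) (l : L) : Commute (f r) (f' l) := hRL r l
  have hinj : Function.Injective (f.noncommCoprod f' hcomm) := by
    rw [MonoidHom.noncommCoprod_injective]
    refine ⟨A.subtype_injective.comp R.subtype_injective,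
      B.subtype_injective.comp L.subtype_injective, ?_⟩
    rw [hf, hf']
    exact hAB.mono (Subgroup.map_subtype_le R) (Subgroup.map_subtype_le L)
  have := residuallyFinite_range _ hinj
  have : (f.noncommCoprod f' hcomm).range.FiniteIndex := by
    rw [MonoidHom.noncommCoprod_range, hf, hf']
    exact finiteIndex_sup_map_subtype hBA R L
  exact residuallyFinite_of_finiteIndex (f.noncommCoprod f' hcomm).range

end Factorization

namespace Mealy

variable {S X : Type} (M : Mealy S X)

theorem genS_mul_genX (s : S) (x : X) :
    M.genS s * M.genX x = M.genX (M.o s x) * M.genS (M.t s x) := by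
  have h := PresentedGroup.one_of_mem (rels := M.rels)
    (Set.mem_iUnion₂.mpr ⟨s, x, Set.mem_singleton _⟩)
  simp only [map_mul, map_inv] at h
  have h' := mul_inv_eq_one.mp h
  exact mul_inv_eq_iff_eq_mul.mp h'

/-- The universal property of `π₁(Δ_A)`. -/
def lift {M : Mealy S X} {G : Type*} [Group G] (f : S → G) (g : X → G)
    (h : ∀ s x, f s * g x = g (M.o s x) * f (M.t s x)) : M.Pi1 →* G :=
  PresentedGroup.toGroup (f := Sum.elim f g) (by
    intro r hr
    obtain ⟨s, x, rfl⟩ := Set.mem_iUnion₂.mp hr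
    simp [h])

section Lift

variable {M} {G : Type*} [Group G] (f : S → G) (g : X → G)
    (h : ∀ s x, f s * g x = g (M.o s x) * f (M.t s x))

@[simp]
theorem lift_genS (s : S) : lift f g h (M.genS s) = f s :=
  PresentedGroup.toGroup.of _

@[simp]
theorem lift_genX (x : X) : lift f g h (M.genX x) = g x :=
  PresentedGroup.toGroup.of _

end Lift

section Extension

variable {M} (ht : ∀ x, Function.Bijective fun s ↦ M.t s x)

/-- Reading a letter, with the output accumulated in the free group. -/
noncomputable def letterPerm (x : X) : Equiv.Perm (S × FreeGroup X) :=
  Equiv.ofBijective (fun z ↦ (M.t z.1 x, z.2 * FreeGroup.of (M.o z.1 x))) (by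
    constructor
    · rintro ⟨s, g⟩ ⟨s', g'⟩ h
      obtain ⟨h1, h2⟩ := Prod.ext_iff.mp h
      obtain rfl : s = s' := (ht x).1 h1
      simpa using h2
    · rintro ⟨s, g⟩
      obtain ⟨s', rfl⟩ := (ht x).2 s
      exact ⟨(s', g * (FreeGroup.of (M.o s' x))⁻¹), by simp⟩)

@[simp]
theorem letterPerm_apply (x : X) (z : S × FreeGroup X) :
    letterPerm ht x z = (M.t z.1 x, z.2 * FreeGroup.of (M.o z.1 x)) := rfl

/-- Reading an element of the free group, with the output accumulated in the free group. -/
noncomputable def readPerm : FreeGroup X →* (Equiv.Perm (S × FreeGroup X))ᵐᵒᵖ :=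
  FreeGroup.lift fun x ↦ MulOpposite.op (letterPerm ht x)

theorem readPerm_mul_snd (g : FreeGroup X) (z : S × FreeGroup X) (k : FreeGroup X) :
    (readPerm ht g).unop (z.1, k * z.2) =
      (((readPerm ht g).unop z).1, k * ((readPerm ht g).unop z).2) := by
  induction g using FreeGroup.induction_on generalizing z with
  | C1 => simp
  | of x => simp [readPerm, mul_assoc]
  | inv_of x h =>
    have := h ((readPerm ht (FreeGroup.of x)⁻¹).unop z)
    rw [map_inv, MulOpposite.unop_inv] at this ⊢
    rw [← Equiv.Perm.mul_apply, mul_inv_cancel, Equiv.Perm.one_apply] at this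
    rw [Equiv.Perm.inv_eq_iff_eq, ← this]
  | mul g g' h h' =>
    simp only [map_mul, MulOpposite.unop_mul, Equiv.Perm.mul_apply, h]
    exact h' _

/-- The output of the automaton on an element of the free group. -/
noncomputable def out (s : S) (g : FreeGroup X) : FreeGroup X := ((readPerm ht g).unop (s, 1)).2

/-- The state of the automaton after reading an element of the free group. -/
noncomputable def next (s : S) (g : FreeGroup X) : S := ((readPerm ht g).unop (s, 1)).1

theorem out_of (s : S) (x : X) : out ht s (FreeGroup.of x) = FreeGroup.of (M.o s x) := by
  simp [out, readPerm]

theorem next_of (s : S) (x : X) : next ht s (FreeGroup.of x) = M.t s x := by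
  simp [next, readPerm]

@[simp]
theorem out_one (s : S) : out ht s 1 = 1 := by simp [out]

@[simp]
theorem next_one (s : S) : next ht s 1 = s := by simp [next]

theorem readPerm_mul (s : S) (g g' : FreeGroup X) :
    (readPerm ht (g * g')).unop (s, 1) =
      (next ht (next ht s g) g', out ht s g * out ht (next ht s g) g') := by
  simpa [out, next] using readPerm_mul_snd ht g' (next ht s g, 1) (out ht s g)

theorem out_mul (s : S) (g g' : FreeGroup X) :
    out ht s (g * g') = out ht s g * out ht (next ht s g) g' :=
  congrArg Prod.snd (readPerm_mul ht s g g')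

theorem next_mul (s : S) (g g' : FreeGroup X) :
    next ht s (g * g') = next ht (next ht s g) g' :=
  (congrArg Prod.fst (readPerm_mul ht s g g') :)

theorem next_inv_next (s : S) (g : FreeGroup X) : next ht (next ht s g⁻¹) g = s := by
  rw [← next_mul, inv_mul_cancel, next_one]

theorem out_inv (s : S) (g : FreeGroup X) : out ht s g⁻¹ = (out ht (next ht s g⁻¹) g)⁻¹ := by
  rw [eq_inv_iff_mul_eq_one, ← out_mul, inv_mul_cancel, out_one]

theorem out_out {M' : Mealy S X} (ht' : ∀ x, Function.Bijective fun s ↦ M'.t s x)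
    (ho : ∀ s x, M'.o s (M.o s x) = x) (htt : ∀ s x, M'.t s (M.o s x) = M.t s x)
    (s : S) (g : FreeGroup X) :
    out ht' s (out ht s g) = g ∧ next ht' s (out ht s g) = next ht s g := by
  induction g using FreeGroup.induction_on generalizing s with
  | C1 => simp
  | of x => simp [out_of, next_of, ho, htt]
  | inv_of x h =>
    have h1 := h (next ht s (FreeGroup.of x)⁻¹)
    rw [next_inv_next] at h1
    have h2 : next ht' s (out ht s (FreeGroup.of x)⁻¹) = next ht s (FreeGroup.of x)⁻¹ := by
      have h3 := next_mul ht' (next ht s (FreeGroup.of x)⁻¹)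
        (out ht (next ht s (FreeGroup.of x)⁻¹) (FreeGroup.of x))
        (out ht (next ht s (FreeGroup.of x)⁻¹) (FreeGroup.of x))⁻¹
      rw [mul_inv_cancel, next_one, h1.2] at h3
      rw [out_inv, ← h3]
    refine ⟨?_, h2⟩
    have h4 := out_inv ht' s (out ht (next ht s (FreeGroup.of x)⁻¹) (FreeGroup.of x))
    rw [← out_inv, h2, h1.1] at h4
    exact h4
  | mul g g' h h' =>
    simp only [out_mul, next_mul, h, h', and_self]

end Extension

section Free

variable {M} (hb : M.Bireversible)

include hb in
theorem exists_inverse : ∃ M' : Mealy S X, (∀ x, Function.Bijective fun s ↦ M'.t s x) ∧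
    (∀ s x, M'.o s (M.o s x) = x) ∧ (∀ s x, M'.t s (M.o s x) = M.t s x) ∧
    (∀ s x, M.o s (M'.o s x) = x) ∧ (∀ s x, M.t s (M'.o s x) = M'.t s x) := by
  let e (s : S) : X ≃ X := Equiv.ofBijective _ (hb.1 s)
  have he (s x) : e s x = M.o s x := rfl
  refine ⟨⟨fun s ↦ (e s).symm, fun s x ↦ M.t s ((e s).symm x)⟩, fun y ↦ ⟨?_, ?_⟩, ?_, ?_, ?_, ?_⟩
  · intro s s' h
    have := hb.2.2.1 (a₁ := (s, (e s).symm y)) (a₂ := (s', (e s').symm y)) (by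
      simp only [← he, Equiv.apply_symm_apply]
      exact congrArg _ h)
    exact congrArg Prod.fst this
  · intro s
    obtain ⟨⟨s', x⟩, h⟩ := hb.2.2.2 (y, s)
    obtain ⟨h1, h2⟩ := Prod.ext_iff.mp h
    exact ⟨s', by simpa [← show M.o s' x = y from h1, ← he] using h2⟩
  all_goals simp [← he]

include hb in
theorem exists_action : ∃ Φ : M.Pi1 →* Equiv.Perm (FreeGroup X),
    (∀ x g, Φ (M.genX x) g = FreeGroup.of x * g) ∧ ∀ s, Φ (M.genS s) 1 = 1 := by
  obtain ⟨M', ht', h1, h2, h3, h4⟩ := exists_inverse hb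
  let σ (s : S) : Equiv.Perm (FreeGroup X) :=
    ⟨out hb.2.1 s, out ht' s, fun g ↦ (out_out hb.2.1 ht' h1 h2 s g).1,
      fun g ↦ (out_out ht' hb.2.1 h3 h4 s g).1⟩
  have hσ (s g) : σ s g = out hb.2.1 s g := rfl
  refine ⟨lift σ (fun x ↦ Equiv.mulLeft (FreeGroup.of x)) fun s x ↦ Equiv.ext fun g ↦ ?_,
    fun x g ↦ ?_, fun s ↦ ?_⟩
  · simp [hσ, out_mul, out_of, next_of]
  · simp
  · simp [hσ]

variable (M) in
/-- The homomorphism from the free group on the alphabet. -/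
def freeX : FreeGroup X →* M.Pi1 := FreeGroup.lift M.genX

variable (M) in
/-- The homomorphism from the free group on the states. -/
def freeS : FreeGroup S →* M.Pi1 := FreeGroup.lift M.genS

@[simp]
theorem freeX_of (x : X) : M.freeX (FreeGroup.of x) = M.genX x := FreeGroup.lift_apply_of

@[simp]
theorem freeS_of (s : S) : M.freeS (FreeGroup.of s) = M.genS s := FreeGroup.lift_apply_of

theorem range_freeX : M.freeX.range = M.subX := FreeGroup.range_lift_eq_closure

theorem range_freeS : M.freeS.range = M.subS := FreeGroup.range_lift_eq_closure

include hb in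
theorem freeX_eq_one_of_mem_subS (g : FreeGroup X) (h : M.freeX g ∈ M.subS) : g = 1 := by
  obtain ⟨Φ, hX, hS⟩ := exists_action hb
  have h1 : ∀ g, Φ (M.freeX g) = MulAction.toPermHom (FreeGroup X) (FreeGroup X) g := fun g ↦ by
    rw [← MonoidHom.comp_apply]
    congr 1
    ext x k
    simp [hX]
  have h2 : M.subS ≤
      (MulAction.stabilizer (Equiv.Perm (FreeGroup X)) (1 : FreeGroup X)).comap Φ := by
    rw [subS, Subgroup.closure_le]
    rintro _ ⟨s, rfl⟩
    exact hS s
  have h3 : Φ (M.freeX g) 1 = 1 := h2 h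
  simpa [h1] using h3

include hb in
theorem freeX_injective : Function.Injective M.freeX :=
  (injective_iff_map_eq_one _).mpr fun g hg ↦
    freeX_eq_one_of_mem_subS hb g (hg ▸ one_mem _)

include hb in
theorem subS_inf_subX : M.subS ⊓ M.subX = ⊥ := by
  rw [eq_bot_iff]
  rintro g ⟨hg, hg'⟩
  rw [SetLike.mem_coe, ← range_freeX] at hg'
  obtain ⟨k, rfl⟩ := hg'
  simp [freeX_eq_one_of_mem_subS hb k hg]

variable (M) in
/-- The dual automaton, with the roles of states and letters exchanged. -/
def dual : Mealy X S := ⟨fun x s ↦ M.t s x, fun x s ↦ M.o s x⟩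

include hb in
theorem dual_bireversible : M.dual.Bireversible := by
  refine ⟨hb.2.1, hb.1, ?_⟩
  have : (fun p : X × S ↦ (M.dual.o p.1 p.2, M.dual.t p.1 p.2)) =
      Prod.swap ∘ (fun p : S × X ↦ (M.o p.1 p.2, M.t p.1 p.2)) ∘ Prod.swap := rfl
  rw [this]
  exact Prod.swap_bijective.comp (hb.2.2.comp Prod.swap_bijective)

include hb in
theorem freeS_injective : Function.Injective M.freeS := by
  let δ : M.Pi1 →* M.dual.Pi1 := lift (fun s ↦ (M.dual.genX s)⁻¹) (fun x ↦ (M.dual.genS x)⁻¹) (by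
    intro s x
    rw [← mul_inv_rev, ← mul_inv_rev, inv_inj]
    exact M.dual.genS_mul_genX x s)
  let ν : FreeGroup S →* FreeGroup S := FreeGroup.lift fun s ↦ (FreeGroup.of s)⁻¹
  have hν : ν.comp ν = MonoidHom.id _ := by
    ext s
    simp [ν]
  have h : δ.comp M.freeS = M.dual.freeX.comp ν := by
    ext s
    simp [δ, ν]
  have h1 : Function.Injective (δ.comp M.freeS) := by
    rw [h]
    exact (freeX_injective (dual_bireversible hb)).comp
      (Function.LeftInverse.injective fun g ↦ DFunLike.congr_fun hν g)
  exact Function.Injective.of_comp (f := δ) h1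

end Free

section Words

variable {M} (ho : ∀ s, Function.Bijective (M.o s))

include ho in
theorem actWord_bijective (s : S) : Function.Bijective (M.actWord s) := by
  constructor
  · intro w w' h
    induction w generalizing s w' with
    | nil => cases w' with
      | nil => rfl
      | cons x w' => simp [actWord] at h
    | cons x w ih => cases w' with
      | nil => simp [actWord] at h
      | cons x' w' =>
        simp only [actWord, List.cons.injEq] at h
        obtain rfl := (ho s).1 h.1
        rw [ih _ h.2]
  · intro w
    induction w generalizing s with
    | nil => exact ⟨[], rfl⟩
    | cons y w ih =>
      obtain ⟨x, rfl⟩ := (ho s).2 y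
      obtain ⟨w, rfl⟩ := ih (M.t s x)
      exact ⟨x :: w, rfl⟩

/-- The action of the free group on the states on words over the alphabet. -/
noncomputable def wordAction : FreeGroup S →* Equiv.Perm (List X) :=
  FreeGroup.lift fun s ↦ Equiv.ofBijective _ (actWord_bijective ho s)

@[simp]
theorem wordAction_of (s : S) (w : List X) :
    wordAction ho (FreeGroup.of s) w = M.actWord s w := by
  simp [wordAction]

theorem range_wordAction : (wordAction ho).range = M.autGroup := by
  rw [wordAction, FreeGroup.range_lift_eq_closure, autGroup]
  congr 1
  ext σ
  refine exists_congr fun s ↦ ⟨fun h ↦ h ▸ rfl, fun h ↦ DFunLike.coe_injective h.symm⟩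

theorem wordAction_nil (u : FreeGroup S) : wordAction ho u [] = [] := by
  induction u using FreeGroup.induction_on with
  | C1 => simp
  | of s => simp [actWord]
  | inv_of s h => rw [map_inv, Equiv.Perm.inv_eq_iff_eq, h]
  | mul u v hu hv => simp [hu, hv]

theorem wordAction_mk_cons (l : List (S × Bool)) (x : X) : ∃ (y : X) (l' : List (S × Bool)),
    l'.length = l.length ∧
    (∀ w, wordAction ho (FreeGroup.mk l) (x :: w) = y :: wordAction ho (FreeGroup.mk l') w) ∧
    M.freeS (FreeGroup.mk l) * M.genX x = M.genX y * M.freeS (FreeGroup.mk l') := by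
  have hcons (s : S) (l : List (S × Bool)) :
      FreeGroup.mk ((s, true) :: l) = FreeGroup.of s * FreeGroup.mk l ∧
      FreeGroup.mk ((s, false) :: l) = (FreeGroup.of s)⁻¹ * FreeGroup.mk l := by
    simp [FreeGroup.of, FreeGroup.inv_mk, FreeGroup.invRev]
  induction l with
  | nil => exact ⟨x, [], by simp [← FreeGroup.one_eq_mk]⟩
  | cons a l ih =>
    obtain ⟨z, l', hl, h1, h2⟩ := ih
    obtain ⟨s, _ | _⟩ := a
    · obtain ⟨y, rfl⟩ := (ho s).2 z
      refine ⟨y, (M.t s y, false) :: l', by simp [hl], fun w ↦ ?_, ?_⟩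
      · rw [(hcons _ _).2, (hcons _ _).2, map_mul, Equiv.Perm.mul_apply, h1, map_inv,
          Equiv.Perm.inv_eq_iff_eq, wordAction_of, actWord, ← wordAction_of ho,
          ← Equiv.Perm.mul_apply, ← map_mul, mul_inv_cancel_left]
      · rw [(hcons _ _).2, (hcons _ _).2, map_mul, mul_assoc, h2, map_mul, map_inv, map_inv,
          freeS_of, freeS_of, inv_mul_eq_iff_eq_mul, ← mul_assoc, ← mul_assoc, genS_mul_genX,
          mul_inv_cancel_right]
    · refine ⟨M.o s z, (M.t s z, true) :: l', by simp [hl], fun w ↦ ?_, ?_⟩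
      · rw [(hcons _ _).1, (hcons _ _).1, map_mul, Equiv.Perm.mul_apply, h1, wordAction_of,
          actWord, ← wordAction_of ho, ← Equiv.Perm.mul_apply, ← map_mul]
      · rw [(hcons _ _).1, (hcons _ _).1, map_mul, mul_assoc, h2, map_mul, freeS_of, freeS_of,
          ← mul_assoc, genS_mul_genX, mul_assoc]

theorem wordAction_cons (u : FreeGroup S) (x : X) : ∃ (y : X) (u' : FreeGroup S),
    (∀ w, wordAction ho u (x :: w) = y :: wordAction ho u' w) ∧
      M.freeS u * M.genX x = M.genX y * M.freeS u' := by
  obtain ⟨l, rfl⟩ := Quot.exists_rep u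
  obtain ⟨y, l', -, h⟩ := wordAction_mk_cons ho l x
  exact ⟨y, _, h⟩

end Words

section Finiteness

variable {M}

theorem freeS_mem (u : FreeGroup S) : M.freeS u ∈ M.subS := range_freeS.le ⟨u, rfl⟩

theorem exists_inv_genX_mul_genX_mem {ho : ∀ s, Function.Bijective (M.o s)} {N E : Subgroup M.Pi1}
    [N.Normal] (hNE : N ≤ E) (hE : M.subS ≤ E) (w : List X) (u : FreeGroup S)
    (hu : M.freeS u ∈ N) (hw : wordAction ho u w ≠ w) :
    ∃ x y, x ≠ y ∧ (M.genX y)⁻¹ * M.genX x ∈ E := by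
  induction w generalizing u with
  | nil => exact absurd (wordAction_nil ho u) hw
  | cons x w ih =>
    obtain ⟨y, u', h1, h2⟩ := wordAction_cons ho u x
    have h3 : (M.genX x)⁻¹ * M.freeS u * M.genX x ∈ N := by
      simpa using ‹N.Normal›.conj_mem _ hu (M.genX x)⁻¹
    rcases eq_or_ne x y with rfl | hxy
    · refine ih u' ?_ fun h ↦ hw (by rw [h1, h])
      rwa [mul_assoc, h2, inv_mul_cancel_left] at h3
    · refine ⟨x, y, hxy, ?_⟩
      have h4 : (M.genX y)⁻¹ * M.genX x =
          M.freeS u' * ((M.genX x)⁻¹ * M.freeS u * M.genX x)⁻¹ := by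
        rw [mul_assoc, h2]
        group
      rw [h4]
      exact E.mul_mem (hE (freeS_mem u')) (E.inv_mem (hNE h3))

theorem finite_autGroup [Finite X] (hb : M.Bireversible)
    (hsep : ∀ g ∉ M.subS, ∃ E : Subgroup M.Pi1, E.FiniteIndex ∧ M.subS ≤ E ∧ g ∉ E) :
    Finite M.autGroup := by
  choose! E hE hSE hgE using hsep
  have hne (p : {p : X × X // p.1 ≠ p.2}) : (M.genX p.1.2)⁻¹ * M.genX p.1.1 ∉ M.subS := by
    intro h
    have h1 := freeX_eq_one_of_mem_subS hb ((FreeGroup.of p.1.2)⁻¹ * FreeGroup.of p.1.1)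
      (by simpa using h)
    exact p.2 (FreeGroup.of_injective (inv_mul_eq_one.mp h1)).symm
  let E' : Subgroup M.Pi1 := ⨅ p : {p : X × X // p.1 ≠ p.2}, E ((M.genX p.1.2)⁻¹ * M.genX p.1.1)
  have : E'.FiniteIndex := Subgroup.finiteIndex_iInf fun p ↦ hE _ (hne p)
  have hSE' : M.subS ≤ E' := le_iInf fun p ↦ hSE _ (hne p)
  have hker : E'.normalCore.comap M.freeS ≤ (wordAction hb.1).ker := by
    intro u hu
    rw [MonoidHom.mem_ker]
    by_contra hne1
    obtain ⟨w, hw⟩ : ∃ w, wordAction hb.1 u w ≠ w := by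
      by_contra! h
      exact hne1 (Equiv.ext h)
    obtain ⟨x, y, hxy, h⟩ := exists_inv_genX_mul_genX_mem E'.normalCore_le hSE' w u hu hw
    exact hgE _ (hne ⟨(x, y), hxy⟩) (Subgroup.mem_iInf.mp h ⟨(x, y), hxy⟩)
  have : (E'.normalCore.comap M.freeS).FiniteIndex := Subgroup.FiniteIndex.comap _ _
  have : (wordAction hb.1).ker.FiniteIndex := Subgroup.finiteIndex_of_le hker
  rw [← range_wordAction hb.1]
  exact Finite.of_equiv _ (QuotientGroup.quotientKerEquivRange _).toEquiv

end Finiteness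

section Factorization

variable {M} (hb : M.Bireversible)

theorem genS_mul_freeX (ht : ∀ x, Function.Bijective fun s ↦ M.t s x) (s : S) (g : FreeGroup X) :
    M.genS s * M.freeX g = M.freeX (out ht s g) * M.genS (next ht s g) := by
  induction g using FreeGroup.induction_on generalizing s with
  | C1 => simp
  | of x => simp [out_of, next_of, genS_mul_genX]
  | inv_of x h =>
    have h1 := h (next ht s (FreeGroup.of x)⁻¹)
    rw [next_inv_next] at h1
    rw [out_inv, map_inv, map_inv, eq_inv_mul_iff_mul_eq, ← mul_assoc, ← h1, mul_inv_cancel_right]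
  | mul g g' h h' =>
    rw [map_mul, ← mul_assoc, h, mul_assoc, h', out_mul, next_mul, map_mul, mul_assoc]

theorem closure_genS_union_genX :
    Subgroup.closure (Set.range M.genS ∪ Set.range M.genX) = ⊤ := by
  rw [← PresentedGroup.closure_range_of M.rels]
  congr 1
  ext g
  simp [genS, genX]

include hb in
theorem exists_mem_subX_mul_mem_subS (g : M.Pi1) :
    ∃ b ∈ M.subX, ∃ a ∈ M.subS, g = b * a := by
  have hS (s : S) : M.genS s ∈ M.subS := Subgroup.subset_closure ⟨s, rfl⟩
  have hX (x : X) : M.genX x ∈ M.subX := Subgroup.subset_closure ⟨x, rfl⟩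
  have hfX (g : FreeGroup X) : M.freeX g ∈ M.subX := range_freeX.le ⟨g, rfl⟩
  have hg : g ∈ Subgroup.closure (Set.range M.genS ∪ Set.range M.genX) := by
    simp [closure_genS_union_genX]
  induction hg using Subgroup.closure_induction_left with
  | one => exact ⟨1, one_mem _, 1, one_mem _, by simp⟩
  | mul_left k hk _ _ ih =>
    obtain ⟨b, hb', a, ha, rfl⟩ := ih
    rcases hk with ⟨s, rfl⟩ | ⟨x, rfl⟩
    · obtain ⟨g, rfl⟩ := range_freeX.ge hb'
      exact ⟨_, hfX _, _, mul_mem (hS _) ha, by rw [← mul_assoc, genS_mul_freeX hb.2.1, mul_assoc]⟩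
    · exact ⟨_, mul_mem (hX x) hb', a, ha, (mul_assoc _ _ _).symm⟩
  | inv_mul_cancel k hk _ _ ih =>
    obtain ⟨b, hb', a, ha, rfl⟩ := ih
    rcases hk with ⟨s, rfl⟩ | ⟨x, rfl⟩
    · obtain ⟨g, rfl⟩ := range_freeX.ge hb'
      obtain ⟨M', ht', -, -, h3, h4⟩ := exists_inverse hb
      have h5 := genS_mul_freeX hb.2.1 s (out ht' s g)
      rw [(out_out ht' hb.2.1 h3 h4 s g).1] at h5
      refine ⟨_, hfX (out ht' s g), _, mul_mem (inv_mem (hS (next hb.2.1 s (out ht' s g)))) ha, ?_⟩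
      rw [inv_mul_eq_iff_eq_mul, ← mul_assoc, ← mul_assoc, h5, mul_inv_cancel_right]
    · exact ⟨_, mul_mem (inv_mem (hX x)) hb', a, ha, (mul_assoc _ _ _).symm⟩

/-- The elements of `⟨S⟩` that act trivially on words. -/
noncomputable def trivialS : Subgroup M.Pi1 := (wordAction hb.1).ker.map M.freeS

theorem trivialS_le : trivialS hb ≤ M.subS := by
  rintro _ ⟨u, -, rfl⟩
  exact freeS_mem u

/-- The elements of `trivialS` of word length `n`. -/
def trivialSOfLength (n : ℕ) : Set M.Pi1 :=
  {g | ∃ l : List (S × Bool), l.length = n ∧ FreeGroup.mk l ∈ (wordAction hb.1).ker ∧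
    M.freeS (FreeGroup.mk l) = g}

theorem finite_trivialSOfLength [Finite S] (n : ℕ) : (trivialSOfLength hb n).Finite := by
  refine ((List.finite_length_eq (S × Bool) n).image fun l ↦ M.freeS (FreeGroup.mk l)).subset ?_
  rintro _ ⟨l, hl, -, rfl⟩
  exact ⟨l, hl, rfl⟩

theorem inv_genX_conj_mem {n : ℕ} {g : M.Pi1} (hg : g ∈ trivialSOfLength hb n) (x : X) :
    (M.genX x)⁻¹ * g * M.genX x ∈ trivialSOfLength hb n := by
  obtain ⟨l, hl, hk, rfl⟩ := hg
  obtain ⟨y, l', hl', h1, h2⟩ := wordAction_mk_cons hb.1 l x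
  rw [MonoidHom.mem_ker] at hk
  simp only [hk, Equiv.Perm.one_apply, List.cons.injEq] at h1
  obtain rfl : x = y := (h1 []).1
  refine ⟨l', hl'.trans hl, MonoidHom.mem_ker.mpr (Equiv.ext fun w ↦ (h1 w).2.symm), ?_⟩
  rw [mul_assoc, h2, inv_mul_cancel_left]

theorem subX_conj_mem [Finite S] {n : ℕ} {b g : M.Pi1} (hb' : b ∈ M.subX)
    (hg : g ∈ trivialSOfLength hb n) : b * g * b⁻¹ ∈ trivialSOfLength hb n := by
  induction hb' using Subgroup.closure_induction_left with
  | one => simpa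
  | mul_left k hk b _ ih =>
    obtain ⟨x, rfl⟩ := hk
    have hinj : Set.InjOn (fun g ↦ (M.genX x)⁻¹ * g * M.genX x) (trivialSOfLength hb n) :=
      fun g _ g' _ h ↦ mul_left_cancel (mul_right_cancel h)
    obtain ⟨t, ht, hte⟩ := (((finite_trivialSOfLength hb n).injOn_iff_bijOn_of_mapsTo
      fun g hg ↦ inv_genX_conj_mem hb hg x).mp hinj).surjOn ih
    convert ht using 1
    rw [mul_inv_rev, mul_assoc, mul_assoc, ← mul_assoc b, ← mul_assoc (b * g), ← hte]
    group
  | inv_mul_cancel k hk b _ ih =>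
    obtain ⟨x, rfl⟩ := hk
    simpa [mul_assoc] using inv_genX_conj_mem hb ih x

theorem trivialS_normal [Finite S] : (trivialS hb).Normal := by
  refine ⟨fun r hr g ↦ ?_⟩
  obtain ⟨b, hb', a, ha, rfl⟩ := exists_mem_subX_mul_mem_subS hb g
  obtain ⟨u, hu, rfl⟩ := hr
  obtain ⟨v, rfl⟩ := range_freeS.ge ha
  obtain ⟨l, hl⟩ := Quot.exists_rep (v * u * v⁻¹)
  have h1 : FreeGroup.mk l = v * u * v⁻¹ := hl
  have h2 := subX_conj_mem hb hb' ⟨l, rfl, h1 ▸ Subgroup.Normal.conj_mem inferInstance _ hu v, rfl⟩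
  obtain ⟨l', -, h3, h4⟩ := h2
  refine ⟨_, h3, h4.trans ?_⟩
  rw [h1]
  simp [mul_assoc]

include hb in
theorem double_residuallyFinite [Finite S] [Finite X] [Finite M.autGroup] :
    Group.ResiduallyFinite (Monoid.PushoutI (fun _ : Bool ↦ M.subS.subtype)) := by
  have : Group.ResiduallyFinite M.subS :=
    range_freeS (M := M) ▸ residuallyFinite_range _ (freeS_injective hb)
  have : Group.ResiduallyFinite M.subX :=
    range_freeX (M := M) ▸ residuallyFinite_range _ (freeX_injective hb)
  have : (wordAction hb.1).ker.FiniteIndex := by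
    refine ⟨?_⟩
    rw [Subgroup.index_ker, range_wordAction]
    exact Nat.card_pos.ne'
  let R : Subgroup M.subS := (trivialS hb).subgroupOf M.subS
  have hR : R.map M.subS.subtype = trivialS hb := Subgroup.map_subgroupOf_eq_of_le (trivialS_le hb)
  have hRn : (R.map M.subS.subtype).Normal := hR ▸ trivialS_normal hb
  have : R.FiniteIndex := by
    refine ⟨?_⟩
    change (trivialS hb).relIndex M.subS ≠ 0
    rw [← range_freeS, MonoidHom.range_eq_map, trivialS, Subgroup.relIndex_map_map, top_sup_eq,
      Subgroup.relIndex_top_right]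
    exact (Subgroup.finiteIndex_of_le le_sup_left).index_ne_zero
  obtain ⟨F, hF, hFf⟩ := (Subgroup.fg_iff _).mp
    ((Group.fg_iff_subgroup_fg _).mp (wordAction hb.1).ker.fg_of_index_ne_zero)
  have hFk : F ⊆ (wordAction hb.1).ker := hF ▸ Subgroup.subset_closure
  have hcl : Subgroup.closure (M.freeS '' F) = trivialS hb := by
    rw [← MonoidHom.map_closure, hF, trivialS]
  obtain ⟨L, hL, hRL⟩ := exists_finiteIndex_commute (B := M.subX) (hFf.image M.freeS) (by
    rintro _ ⟨u, hu, rfl⟩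
    obtain ⟨l, rfl⟩ := Quot.exists_rep u
    exact ⟨trivialSOfLength hb l.length, finite_trivialSOfLength hb _, ⟨l, rfl, hFk hu, rfl⟩,
      fun b hb' t ht ↦ subX_conj_mem hb hb' ht⟩)
  have hdisj : Disjoint M.subS M.subX := disjoint_iff.mpr (subS_inf_subX hb)
  have : Group.ResiduallyFinite M.Pi1 := residuallyFinite_of_factorization
    (exists_mem_subX_mul_mem_subS hb) hdisj R L fun r l ↦ hRL _ (hcl ▸ r.2) _ l.2
  exact residuallyFinite_double fun g hg ↦ exists_finiteIndex_of_factorization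
    (exists_mem_subX_mul_mem_subS hb) hdisj R L hg

end Factorization

end Mealy

open Mealy in
/-- The double `π₁(Δ_A) *_{⟨S⟩} π₁(Δ_A)` is residually finite iff `G_A` is finite. -/
theorem double_residuallyFinite_iff_finite {S X : Type} [Finite S] [Finite X]
    [Nonempty S] [Nonempty X] (M : Mealy S X) (hb : M.Bireversible) :
    (∀ d : Monoid.PushoutI (fun _ : Bool => M.subS.subtype), d ≠ 1 →
      ∃ N : Subgroup (Monoid.PushoutI (fun _ : Bool => M.subS.subtype)),
        N.Normal ∧ N.FiniteIndex ∧ d ∉ N) ↔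
    Finite M.autGroup := by
  constructor
  · intro h
    have : Group.ResiduallyFinite (Monoid.PushoutI (fun _ : Bool ↦ M.subS.subtype)) :=
      Group.residuallyFinite_iff_exists_finiteIndex.mpr fun d hd ↦
        let ⟨N, _, hN, hdN⟩ := h d hd
        ⟨N, hN, hdN⟩
    exact finite_autGroup hb fun g hg ↦ exists_finiteIndex_of_residuallyFinite_double hg
  · intro _ d hd
    have := double_residuallyFinite hb
    obtain ⟨N, hN⟩ := Group.residuallyFinite_iff_exists_finiteIndexNormalSubgroup.mp this d hd
    exact ⟨N.toSubgroup, inferInstance, inferInstance, hN⟩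
end

section
/- Let G_W be the presented group on generators a, b, c, u, v with the six relations a u = u b, a v = v b, b u = v a, b v = u c, c u = v c, c v = u a. Then the assignment a ↦ a, b ↦ b, c ↦ c, u ↦ u v⁻¹ u v⁻¹ u, v ↦ v u⁻¹ v u⁻¹ v extends to a group endomorphism φ of G_W, and the fixed subgroup of φ equals the subgroup generated by a, b, c: {γ ∈ G_W | φ(γ) = γ} = ⟨a, b, c⟩. -/
namespace WiseComplex

/-- Relators of the fundamental group of the Wise complex, on the generators
`a = 0`, `b = 1`, `c = 2`, `u = 3`, `v = 4`, encoding the relations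
`a u = u b`, `a v = v b`, `b u = v a`, `b v = u c`, `c u = v c`, `c v = u a`. -/
def relsW : Set (FreeGroup (Fin 5)) :=
  { FreeGroup.of 0 * FreeGroup.of 3 * (FreeGroup.of 1)⁻¹ * (FreeGroup.of 3)⁻¹,
    FreeGroup.of 0 * FreeGroup.of 4 * (FreeGroup.of 1)⁻¹ * (FreeGroup.of 4)⁻¹,
    FreeGroup.of 1 * FreeGroup.of 3 * (FreeGroup.of 0)⁻¹ * (FreeGroup.of 4)⁻¹,
    FreeGroup.of 1 * FreeGroup.of 4 * (FreeGroup.of 2)⁻¹ * (FreeGroup.of 3)⁻¹,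
    FreeGroup.of 2 * FreeGroup.of 3 * (FreeGroup.of 2)⁻¹ * (FreeGroup.of 4)⁻¹,
    FreeGroup.of 2 * FreeGroup.of 4 * (FreeGroup.of 0)⁻¹ * (FreeGroup.of 3)⁻¹ }

/-- The fundamental group `G_W` of the Wise complex. -/
abbrev GW := PresentedGroup relsW

/-- The generator `a` of `G_W`. -/
def a : GW := PresentedGroup.of 0
/-- The generator `b` of `G_W`. -/
def b : GW := PresentedGroup.of 1
/-- The generator `c` of `G_W`. -/
def c : GW := PresentedGroup.of 2
/-- The generator `u` of `G_W`. -/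
def u : GW := PresentedGroup.of 3
/-- The generator `v` of `G_W`. -/
def v : GW := PresentedGroup.of 4

end WiseComplex

namespace WiseComplex

section Machine

variable {S α : Type*}

/-- One step of the machine with output function `o` and transition permutations `t`: it reads the
letter `l`, appends the output to the word written so far and changes the state. -/
def step (o : S → α → α) (t : α → Equiv.Perm S) (l : α) : Equiv.Perm (FreeGroup α × S) where
  toFun p := (p.1 * FreeGroup.of (o p.2 l), t l p.2)
  invFun p := (p.1 * (FreeGroup.of (o ((t l).symm p.2) l))⁻¹, (t l).symm p.2)
  left_inv p := by simp
  right_inv p := by simp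

/-- The right action of the free group on pairs (output, state), reading the letters from left to
right. -/
def run (o : S → α → α) (t : α → Equiv.Perm S) :
    FreeGroup α →* (Equiv.Perm (FreeGroup α × S))ᵐᵒᵖ :=
  FreeGroup.lift fun l => MulOpposite.op (step o t l)

/-- The output of the machine started in state `q` on input `x`. -/
def output (o : S → α → α) (t : α → Equiv.Perm S) (q : S) (x : FreeGroup α) : FreeGroup α :=
  ((run o t x).unop (1, q)).1

/-- The final state of the machine started in state `q` on input `x`. -/
def finalState (o : S → α → α) (t : α → Equiv.Perm S) (q : S) (x : FreeGroup α) : S :=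
  ((run o t x).unop (1, q)).2

variable (o : S → α → α) (t : α → Equiv.Perm S)

@[simp] lemma output_one (q : S) : output o t q 1 = 1 := by simp [output]

@[simp] lemma finalState_one (q : S) : finalState o t q 1 = q := by simp [finalState]

@[simp] lemma output_of (q : S) (l : α) :
    output o t q (FreeGroup.of l) = FreeGroup.of (o q l) := by
  simp [output, run, step]

@[simp] lemma finalState_of (q : S) (l : α) : finalState o t q (FreeGroup.of l) = t l q := by
  simp [finalState, run, step]

@[simp] lemma output_inv_of (q : S) (l : α) :
    output o t q (FreeGroup.of l)⁻¹ = (FreeGroup.of (o ((t l).symm q) l))⁻¹ := by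
  simp [output, run, step, Equiv.Perm.inv_def]

@[simp] lemma finalState_inv_of (q : S) (l : α) :
    finalState o t q (FreeGroup.of l)⁻¹ = (t l).symm q := by
  simp [finalState, run, step, Equiv.Perm.inv_def]

lemma run_apply (x y : FreeGroup α) (q : S) :
    (run o t x).unop (y, q) = (y * output o t q x, finalState o t q x) := by
  induction x generalizing y q with
  | C1 => simp
  | of l => simp [run, step]
  | inv_of l => simp [run, step, Equiv.Perm.inv_def]
  | mul x z hx hz =>
    have h (y : FreeGroup α) : (run o t (x * z)).unop (y, q) =
        (y * (output o t q x * output o t (finalState o t q x) z),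
          finalState o t (finalState o t q x) z) := by
      rw [map_mul, MulOpposite.unop_mul, Equiv.Perm.mul_apply, hx, hz, mul_assoc]
    simp only [output, finalState, h, one_mul]

@[simp] lemma output_mul (q : S) (x y : FreeGroup α) :
    output o t q (x * y) = output o t q x * output o t (finalState o t q x) y := by
  rw [output, map_mul, MulOpposite.unop_mul, Equiv.Perm.mul_apply, run_apply, run_apply, one_mul]

@[simp] lemma finalState_mul (q : S) (x y : FreeGroup α) :
    finalState o t q (x * y) = finalState o t (finalState o t q x) y := by
  rw [finalState, map_mul, MulOpposite.unop_mul, Equiv.Perm.mul_apply, run_apply, run_apply]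

lemma output_output_and_finalState_output {o o' : S → α → α} {t t' : α → Equiv.Perm S}
    (ho : ∀ q l, o' q (o q l) = l) (ht : ∀ q l, t' (o q l) q = t l q)
    (q : S) (x : FreeGroup α) :
    output o' t' q (output o t q x) = x ∧
      finalState o' t' q (output o t q x) = finalState o t q x := by
  induction x generalizing q with
  | C1 => simp
  | of l => simp [ho, ht]
  | inv_of l =>
    have h : (t' (o ((t l).symm q) l)).symm q = (t l).symm q := by
      rw [Equiv.symm_apply_eq, ht, Equiv.apply_symm_apply]
    simp [h, ho]
  | mul x y hx hy => simp [hx, hy]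

/-- If elements `s q` of a group move past the images of letters as the machine prescribes, they
move past the images of all words. -/
lemma mul_map_eq_map_output_mul {o : S → α → α} {t : α → Equiv.Perm S} {G : Type*} [Group G]
    (s : S → G) (ι : FreeGroup α →* G)
    (h : ∀ q l, s q * ι (FreeGroup.of l) = ι (FreeGroup.of (o q l)) * s (t l q))
    (q : S) (x : FreeGroup α) :
    s q * ι x = ι (output o t q x) * s (finalState o t q x) := by
  induction x generalizing q with
  | C1 => simp
  | of l => simp [h]
  | inv_of l =>
    have := h ((t l).symm q) l
    rw [Equiv.apply_symm_apply] at this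
    rw [output_inv_of, finalState_inv_of, map_inv, map_inv, eq_inv_mul_iff_mul_eq, ← mul_assoc,
      ← this, mul_inv_cancel_right]
  | mul x y hx hy => simp [← mul_assoc, hx, mul_assoc _ (s _) _, hy]

/-- The permutation of the free group induced by a state of an invertible machine. -/
def outputPerm {o o' : S → α → α} {t t' : α → Equiv.Perm S}
    (ho : ∀ q l, o' q (o q l) = l) (ht : ∀ q l, t' (o q l) q = t l q)
    (ho' : ∀ q l, o q (o' q l) = l) (ht' : ∀ q l, t (o' q l) q = t' l q) (q : S) :
    Equiv.Perm (FreeGroup α) where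
  toFun := output o t q
  invFun := output o' t' q
  left_inv x := (output_output_and_finalState_output ho ht q x).1
  right_inv x := (output_output_and_finalState_output ho' ht' q x).1

end Machine

/-- The output function of the Aleshin automaton; the states `0, 1, 2` are `a, b, c` and the
letters `0, 1` are `u, v`. -/
def out (q : Fin 3) (l : Fin 2) : Fin 2 := if q = 0 then l else Equiv.swap 0 1 l

/-- The transitions of the Aleshin automaton. -/
def trans : Fin 2 → Equiv.Perm (Fin 3) := ![Equiv.swap 0 1, finRotate 3]

/-- The transitions of the inverse of the Aleshin automaton. -/
def transInv : Fin 2 → Equiv.Perm (Fin 3) := ![finRotate 3, Equiv.swap 0 1]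

lemma out_out : ∀ q l, out q (out q l) = l := by decide

lemma transInv_out : ∀ q l, transInv (out q l) q = trans l q := by decide

lemma trans_out : ∀ q l, trans (out q l) q = transInv l q := by decide

section Lift

variable {G : Type*} [Group G] (s : Fin 3 → G) (x : Fin 2 → G)

lemma lift_relsW (h : ∀ q l, s q * x l = x (out q l) * s (trans l q))
    (r : FreeGroup (Fin 5)) (hr : r ∈ relsW) :
    FreeGroup.lift ![s 0, s 1, s 2, x 0, x 1] r = 1 := by
  rcases hr with rfl | rfl | rfl | rfl | rfl | rfl <;>
    simp [mul_inv_eq_iff_eq_mul, h] <;> rfl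

/-- The homomorphism out of `G_W` determined by elements satisfying the relations of the Aleshin
automaton. -/
def lift (h : ∀ q l, s q * x l = x (out q l) * s (trans l q)) : GW →* G :=
  PresentedGroup.toGroup (lift_relsW s x h)

end Lift

/-- The generators `a, b, c`, as states of the Aleshin automaton. -/
def stateGen : Fin 3 → GW := ![a, b, c]

/-- The generators `u, v`, as letters of the Aleshin automaton. -/
def letterGen : Fin 2 → GW := ![u, v]

lemma stateGen_mul_letterGen (q : Fin 3) (l : Fin 2) :
    stateGen q * letterGen l = letterGen (out q l) * stateGen (trans l q) := by
  have key {i j k m : Fin 5} (hr : FreeGroup.of i * FreeGroup.of j * (FreeGroup.of k)⁻¹ *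
      (FreeGroup.of m)⁻¹ ∈ relsW) :
      (PresentedGroup.of i * PresentedGroup.of j : GW) =
        PresentedGroup.of m * PresentedGroup.of k := by
    have := PresentedGroup.one_of_mem hr
    rwa [map_mul, map_mul, map_mul, map_inv, map_inv, mul_inv_eq_iff_eq_mul, one_mul,
      mul_inv_eq_iff_eq_mul] at this
  fin_cases q <;> fin_cases l <;> exact key (by simp [relsW])

/-- The homomorphism from the free group on `u, v` to `G_W`. -/
def letterHom : FreeGroup (Fin 2) →* GW := FreeGroup.lift letterGen

lemma stateGen_mul_letterHom (q : Fin 3) (x : FreeGroup (Fin 2)) :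
    stateGen q * letterHom x =
      letterHom (output out trans q x) * stateGen (finalState out trans q x) :=
  mul_map_eq_map_output_mul stateGen letterHom
    (by simpa [letterHom] using stateGen_mul_letterGen) q x

lemma inv_stateGen_mul_letterHom (q : Fin 3) (x : FreeGroup (Fin 2)) :
    (stateGen q)⁻¹ * letterHom x =
      letterHom (output out transInv q x) * (stateGen (finalState out transInv q x))⁻¹ := by
  refine mul_map_eq_map_output_mul (fun q => (stateGen q)⁻¹) letterHom (fun q l => ?_) q x
  have := stateGen_mul_letterGen q (out q l)
  rw [out_out, trans_out] at this
  simp [letterHom, eq_mul_inv_iff_mul_eq, mul_assoc, inv_mul_eq_iff_eq_mul, this]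

/-- The action of `G_W` on the free group on `u, v`, in which `u, v` act by left translation and
`a, b, c` through the Aleshin automaton. -/
def action : GW →* Equiv.Perm (FreeGroup (Fin 2)) :=
  lift (outputPerm out_out transInv_out out_out trans_out)
    (fun l => Equiv.mulLeft (FreeGroup.of l)) fun q l => by
      ext1 x
      simp [outputPerm]

lemma action_letterHom (x : FreeGroup (Fin 2)) : action (letterHom x) = Equiv.mulLeft x := by
  have h : action.comp letterHom = MulAction.toPermHom (FreeGroup (Fin 2)) _ := by
    ext1 l
    fin_cases l <;> ext1 y <;>
      simp [action, lift, letterHom, letterGen, u, v, PresentedGroup.toGroup.of]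
  ext1 y
  exact congrArg (fun f : Equiv.Perm _ => f y) (DFunLike.congr_fun h x)

lemma letterHom_injective : Function.Injective letterHom := fun x y h => by
  simpa [action_letterHom] using congrArg (fun g => action g 1) h

lemma exists_eq_letterHom_mul (γ : GW) :
    ∃ x, ∃ w ∈ Subgroup.closure {a, b, c}, γ = letterHom x * w := by
  have hs (q : Fin 3) : stateGen q ∈ Subgroup.closure {a, b, c} :=
    Subgroup.subset_closure (by fin_cases q <;> simp [stateGen])
  suffices h : ∀ y, ∃ x, ∃ w ∈ Subgroup.closure {a, b, c}, γ * letterHom y = letterHom x * w by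
    simpa using h 1
  have hstate (q : Fin 3) (y) : ∃ x, ∃ w ∈ Subgroup.closure {a, b, c},
      stateGen q * letterHom y = letterHom x * w :=
    ⟨_, _, hs _, stateGen_mul_letterHom q y⟩
  have hstate' (q : Fin 3) (y) : ∃ x, ∃ w ∈ Subgroup.closure {a, b, c},
      (stateGen q)⁻¹ * letterHom y = letterHom x * w :=
    ⟨_, _, inv_mem (hs _), inv_stateGen_mul_letterHom q y⟩
  have hletter (z y) : ∃ x, ∃ w ∈ Subgroup.closure {a, b, c},
      letterHom z * letterHom y = letterHom x * w :=
    ⟨z * y, 1, one_mem _, by simp⟩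
  have hu : PresentedGroup.of 3 = letterHom (FreeGroup.of 0) := by simp [letterHom, letterGen, u]
  have hv : PresentedGroup.of 4 = letterHom (FreeGroup.of 1) := by simp [letterHom, letterGen, v]
  induction γ using PresentedGroup.induction_on with | _ g
  induction g with
  | C1 => exact fun y => ⟨y, 1, one_mem _, by simp⟩
  | of i =>
    fin_cases i
    · exact hstate 0
    · exact hstate 1
    · exact hstate 2
    · exact hu ▸ hletter (FreeGroup.of 0)
    · exact hv ▸ hletter (FreeGroup.of 1)
  | inv_of i =>
    fin_cases i
    · exact hstate' 0
    · exact hstate' 1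
    · exact hstate' 2
    · have := hletter (FreeGroup.of 0)⁻¹
      rwa [map_inv, ← hu] at this
    · have := hletter (FreeGroup.of 1)⁻¹
      rwa [map_inv, ← hv] at this
  | mul g h hg hh =>
    intro y
    obtain ⟨x, w, hw, hx⟩ := hh y
    obtain ⟨z, w', hw', hz⟩ := hg x
    exact ⟨z, w' * w, mul_mem hw' hw, by rw [map_mul, mul_assoc, hx, ← mul_assoc, hz, mul_assoc]⟩

/-- The word substituted for a signed letter by the endomorphism. -/
def block (p : Fin 2 × Bool) : List (Fin 2 × Bool) :=
  [p, (Equiv.swap 0 1 p.1, !p.2), p, (Equiv.swap 0 1 p.1, !p.2), p]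

/-- The endomorphism `u ↦ uv⁻¹uv⁻¹u`, `v ↦ vu⁻¹vu⁻¹v` of the free group on `u, v`. -/
def freeEndo : FreeGroup (Fin 2) →* FreeGroup (Fin 2) :=
  FreeGroup.lift fun l => FreeGroup.mk (block (l, true))

lemma freeEndo_mk (L : List (Fin 2 × Bool)) :
    freeEndo (FreeGroup.mk L) = FreeGroup.mk (L.map block).flatten := by
  induction L with
  | nil => exact map_one freeEndo
  | cons p L ih =>
    have hp : freeEndo (FreeGroup.mk [p]) = FreeGroup.mk (block p) := by
      obtain ⟨l, _ | _⟩ := p <;> simp [freeEndo, block, FreeGroup.inv_mk, FreeGroup.invRev]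
    rw [← List.singleton_append, ← FreeGroup.mul_mk, map_mul, hp, ih, FreeGroup.mul_mk]
    simp

lemma isReduced_flatten_map_block {L : List (Fin 2 × Bool)} (hL : FreeGroup.IsReduced L) :
    FreeGroup.IsReduced (L.map block).flatten := by
  rw [FreeGroup.IsReduced, List.isChain_flatten (by simp [block])]
  refine ⟨?_, ?_⟩
  · simp only [List.forall_mem_map]
    exact fun p _ => (by unfold FreeGroup.IsReduced; decide :
      ∀ p, FreeGroup.IsReduced (block p)) p
  · rw [List.isChain_map]
    simpa [block, FreeGroup.IsReduced] using hL

lemma norm_freeEndo (x : FreeGroup (Fin 2)) : (freeEndo x).norm = 5 * x.norm := by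
  have h := isReduced_flatten_map_block (FreeGroup.isReduced_toWord (x := x))
  conv_lhs => rw [← FreeGroup.mk_toWord (x := x), freeEndo_mk]
  rw [FreeGroup.norm, FreeGroup.toWord_mk, h.reduce_eq, FreeGroup.norm]
  simp [List.length_flatten, Function.comp_def, block, mul_comm]

lemma eq_one_of_freeEndo_eq_self {x : FreeGroup (Fin 2)} (hx : freeEndo x = x) : x = 1 := by
  have := norm_freeEndo x
  rw [hx] at this
  exact FreeGroup.norm_eq_zero.mp (by lia)

lemma freeEndo_of (l : Fin 2) : freeEndo (FreeGroup.of l) =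
    FreeGroup.of l * (FreeGroup.of (Equiv.swap 0 1 l))⁻¹ * FreeGroup.of l *
      (FreeGroup.of (Equiv.swap 0 1 l))⁻¹ * FreeGroup.of l := by
  simp [freeEndo, block, FreeGroup.of, FreeGroup.inv_mk, FreeGroup.invRev]

lemma output_freeEndo_of (q : Fin 3) (l : Fin 2) :
    output out trans q (freeEndo (FreeGroup.of l)) = freeEndo (FreeGroup.of (out q l)) := by
  revert q l
  decide

lemma finalState_freeEndo_of (q : Fin 3) (l : Fin 2) :
    finalState out trans q (freeEndo (FreeGroup.of l)) = trans l q := by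
  revert q l
  decide

/-- The endomorphism of `G_W` fixing `a, b, c` and extending `freeEndo`. -/
def endo : GW →* GW :=
  lift stateGen (fun l => letterHom (freeEndo (FreeGroup.of l))) fun q l => by
    rw [stateGen_mul_letterHom, output_freeEndo_of, finalState_freeEndo_of]

lemma endo_letterHom (x : FreeGroup (Fin 2)) : endo (letterHom x) = letterHom (freeEndo x) := by
  have h : endo.comp letterHom = letterHom.comp freeEndo := by
    ext l
    fin_cases l <;>
      simp [endo, lift, letterHom, letterGen, u, v, PresentedGroup.toGroup.of]
  exact DFunLike.congr_fun h x

lemma endo_a : endo a = a := by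
  simp [endo, lift, stateGen, a, PresentedGroup.toGroup.of]

lemma endo_b : endo b = b := by
  simp [endo, lift, stateGen, b, PresentedGroup.toGroup.of]

lemma endo_c : endo c = c := by
  simp [endo, lift, stateGen, c, PresentedGroup.toGroup.of]

lemma endo_eq_self_of_mem {w : GW} (hw : w ∈ Subgroup.closure {a, b, c}) : endo w = w := by
  have h : Set.EqOn endo (MonoidHom.id GW) {a, b, c} := by
    rintro _ (rfl | rfl | rfl)
    exacts [endo_a, endo_b, endo_c]
  exact MonoidHom.eqOn_closure h hw

lemma endo_eq_self_iff (γ : GW) : endo γ = γ ↔ γ ∈ Subgroup.closure {a, b, c} := by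
  refine ⟨fun h => ?_, endo_eq_self_of_mem⟩
  obtain ⟨x, w, hw, rfl⟩ := exists_eq_letterHom_mul γ
  rw [map_mul, endo_eq_self_of_mem hw, endo_letterHom, mul_left_inj] at h
  rwa [eq_one_of_freeEndo_eq_self (letterHom_injective h), map_one, one_mul]

end WiseComplex

open WiseComplex in
/-- The assignment `a ↦ a`, `b ↦ b`, `c ↦ c`, `u ↦ uv⁻¹uv⁻¹u`, `v ↦ vu⁻¹vu⁻¹v` extends
to an endomorphism of `G_W` whose fixed subgroup is `⟨a, b, c⟩`. -/
theorem wise_endomorphism :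
    ∃ φ : GW →* GW,
      φ a = a ∧ φ b = b ∧ φ c = c ∧
      φ u = u * v⁻¹ * u * v⁻¹ * u ∧
      φ v = v * u⁻¹ * v * u⁻¹ * v ∧
      (∀ γ : GW, φ γ = γ ↔ γ ∈ Subgroup.closure {a, b, c}) := by
  refine ⟨endo, endo_a, endo_b, endo_c, ?_, ?_, endo_eq_self_iff⟩
  · have := endo_letterHom (FreeGroup.of 0)
    simpa [freeEndo_of, letterHom, letterGen] using this
  · have := endo_letterHom (FreeGroup.of 1)
    simpa [freeEndo_of, letterHom, letterGen] using this
end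

section
/- Let G_W be the presented group on generators a, b, c, u, v with the six relations a u = u b, a v = v b, b u = v a, b v = u c, c u = v c, c v = u a. Then the element (u⁻¹v)⁴ is nontrivial in G_W and belongs to every finite-index subgroup of G_W. In particular, G_W is not residually finite. -/
namespace WiseComplex

/-! ### The Aleshin automaton

The states `0, 1, 2` stand for `a, b, c` and the letters `false, true` for `u, v`. -/

/-- Whether a state of the Aleshin automaton exchanges the two letters. -/
def flips (i : Fin 3) : Bool := decide (i ≠ 0)

/-- The permutation of the states of the Aleshin automaton induced by a letter. -/
def next (y : Bool) : Equiv.Perm (Fin 3) := bif y then finRotate 3 else Equiv.swap 0 1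

/-- The square relations of the Aleshin automaton for families `s` of states and `x` of letters
in a group. -/
def SquareRelations {G : Type*} [Group G] (s : Fin 3 → G) (x : Bool → G) : Prop :=
  ∀ i y, s i * x y = x (flips i ^^ y) * s (next y i)

theorem squareRelations_iff {G : Type*} [Group G] (s : Fin 3 → G) (x : Bool → G) :
    SquareRelations s x ↔
      s 0 * x false = x false * s 1 ∧ s 0 * x true = x true * s 1 ∧
      s 1 * x false = x true * s 0 ∧ s 1 * x true = x false * s 2 ∧
      s 2 * x false = x true * s 2 ∧ s 2 * x true = x false * s 0 := by
  have e1 : next false 2 = 2 := by decide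
  have e2 : next true 0 = 1 := by decide
  have e3 : next true 1 = 2 := by decide
  have e4 : next true 2 = 0 := by decide
  have e5 : next false 0 = 1 := by decide
  have e6 : next false 1 = 0 := by decide
  simp [SquareRelations, Fin.forall_fin_succ, e1, e2, e3, e4, e5, e6, flips, and_assoc]

/-! ### Words in the states -/

/-- Whether a word in the states exchanges the two letters. -/
def wordFlips : List (Fin 3) → Bool
  | [] => false
  | i :: w => flips i ^^ wordFlips w

/-- The section of a word in the states at a letter. -/
def wordSection : List (Fin 3) → Bool → List (Fin 3)
  | [], _ => []
  | i :: w, y => next (wordFlips w ^^ y) i :: wordSection w y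

/-- Whether a word in the states contains an odd number of letters `a` and `c`. -/
def wordInverts : List (Fin 3) → Bool
  | [] => false
  | i :: w => decide (i ≠ 1) ^^ wordInverts w

theorem wordFlips_append (w z : List (Fin 3)) :
    wordFlips (w ++ z) = (wordFlips w ^^ wordFlips z) := by
  induction w with
  | nil => simp [wordFlips]
  | cons i w ih => simp [wordFlips, ih]

theorem wordInverts_append (w z : List (Fin 3)) :
    wordInverts (w ++ z) = (wordInverts w ^^ wordInverts z) := by
  induction w with
  | nil => simp [wordInverts]
  | cons i w ih => simp [wordInverts, ih]

theorem wordInverts_wordSection (w : List (Fin 3)) (y : Bool) :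
    wordInverts (wordSection w y) = wordFlips w := by
  have h : ∀ i y, decide (next y i ≠ 1) = flips i := by decide
  induction w with
  | nil => rfl
  | cons i w ih => simp only [wordSection, wordInverts, wordFlips, ih, h]

theorem wordFlips_wordSection (w : List (Fin 3)) :
    (wordFlips (wordSection w true) ^^ wordFlips (wordSection w false)) = wordFlips w := by
  have h : ∀ i y, (flips (next (y ^^ true) i) ^^ flips (next (y ^^ false) i)) = flips i := by
    decide
  induction w with
  | nil => rfl
  | cons i w ih =>
    simp only [wordSection, wordFlips]
    rw [← h i (wordFlips w), ← ih]
    simp only [Bool.xor_assoc, Bool.xor_left_comm]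

section Relations

variable {G : Type*} [Group G] {s : Fin 3 → G} {x : Bool → G}

theorem SquareRelations.prod_mul (h : SquareRelations s x) (w : List (Fin 3)) (y : Bool) :
    (w.map s).prod * x y = x (wordFlips w ^^ y) * ((wordSection w y).map s).prod := by
  induction w with
  | nil => simp [wordFlips, wordSection]
  | cons i w ih =>
    simp only [wordFlips, wordSection, List.map_cons, List.prod_cons]
    rw [mul_assoc, ih, ← mul_assoc, h, mul_assoc, Bool.xor_assoc]

theorem SquareRelations.state_conj (h : SquareRelations s x) (i : Fin 3) :
    SemiconjBy (s i) (((x false)⁻¹ * x true) ^ 2)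
      (if i ≠ 1 then (((x false)⁻¹ * x true) ^ 2)⁻¹ else ((x false)⁻¹ * x true) ^ 2) := by
  obtain ⟨h1, h2, h3, h4, h5, h6⟩ := (squareRelations_iff s x).1 h
  have hv : x true = x false * ((x false)⁻¹ * x true) := by group
  generalize (x false)⁻¹ * x true = t at hv ⊢
  rw [hv] at h2 h3 h4 h5 h6
  have hb : s 1 * t = t * s 1 := by
    rw [← mul_assoc, h1] at h2
    simpa [mul_assoc] using h2
  have hac : s 0 * t = t⁻¹ * s 2 := by
    rw [← mul_assoc, h3] at h4
    simpa [mul_assoc, eq_inv_mul_iff_mul_eq] using h4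
  have hca : s 2 * t = t⁻¹ * s 0 := by
    rw [← mul_assoc, h5] at h6
    simpa [mul_assoc, eq_inv_mul_iff_mul_eq] using h6
  fin_cases i
  · change s 0 * t ^ 2 = (t ^ 2)⁻¹ * s 0
    rw [pow_two, ← mul_assoc, hac, mul_assoc, hca, mul_inv_rev, mul_assoc]
  · exact SemiconjBy.pow_right (a := s 1) (x := t) (y := t) hb 2
  · change s 2 * t ^ 2 = (t ^ 2)⁻¹ * s 2
    rw [pow_two, ← mul_assoc, hca, mul_assoc, hac, mul_inv_rev, mul_assoc]

theorem SquareRelations.prod_conj (h : SquareRelations s x) (w : List (Fin 3)) :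
    SemiconjBy (w.map s).prod (((x false)⁻¹ * x true) ^ 2)
      (if wordInverts w then (((x false)⁻¹ * x true) ^ 2)⁻¹ else ((x false)⁻¹ * x true) ^ 2) := by
  induction w with
  | nil => simp [wordInverts]
  | cons i w ih =>
    have hi := h.state_conj i
    simp only [wordInverts, List.map_cons, List.prod_cons]
    generalize ((x false)⁻¹ * x true) ^ 2 = r at hi ih ⊢
    by_cases hi1 : i = 1 <;> by_cases hw : wordInverts w = true <;>
      simp only [hi1, hw, ne_eq, not_true_eq_false, not_false_eq_true, if_true, if_false,
        decide_true, decide_false, Bool.xor_false, Bool.xor_true, Bool.not_true, Bool.not_false,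
        Bool.false_eq_true] at hi ih ⊢
    · exact hi.inv_right.mul_left ih
    · exact hi.mul_left ih
    · simpa using hi.inv_right.mul_left ih
    · exact hi.mul_left ih

/-- A word exchanging the two letters can only have finite order if `(u⁻¹v)⁴ = 1`. -/
theorem SquareRelations.pow_four_eq_one (h : SquareRelations s x) (n : ℕ) (hn : 0 < n)
    (w : List (Fin 3)) (hw : wordFlips w = true) (hwn : (w.map s).prod ^ n = 1) :
    ((x false)⁻¹ * x true) ^ 4 = 1 := by
  induction n using Nat.strong_induction_on generalizing w with
  | _ n ih =>
    set z := wordSection w true ++ wordSection w false with hz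
    have hsq : SemiconjBy (x false)⁻¹ ((w.map s).prod ^ 2) (z.map s).prod := by
      have h0 := h.prod_mul w false
      have h1 := h.prod_mul w true
      rw [hw] at h0 h1
      simp only [Bool.xor_false, Bool.xor_true, Bool.not_true] at h0 h1
      rw [SemiconjBy.inv_symm_left_iff]
      rw [SemiconjBy, pow_two, mul_assoc, h0, ← mul_assoc, h1, hz, List.map_append,
        List.prod_append, mul_assoc]
    obtain ⟨k, hk | hk⟩ := n.even_or_odd'
    · refine ih k (by omega) (by omega) z ?_ ?_
      · rw [hz, wordFlips_append, wordFlips_wordSection, hw]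
      · have := hsq.pow_right k
        rw [← pow_mul, ← hk, hwn] at this
        simpa [SemiconjBy] using this.symm
    · set t := (x false)⁻¹ * x true with ht
      have hzt : SemiconjBy (z.map s).prod (t ^ 2) (t ^ 2) := by
        have := h.prod_conj z
        rwa [hz, wordInverts_append, wordInverts_wordSection, wordInverts_wordSection,
          Bool.xor_self, if_neg Bool.false_ne_true, ← hz] at this
      have hzk : SemiconjBy ((z.map s).prod ^ k) (t ^ 2) (t ^ 2) := Commute.pow_left hzt k
      have hu : SemiconjBy ((wordSection w false).map s).prod (t ^ 2) (t ^ 2)⁻¹ := by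
        have := h.prod_conj (wordSection w false)
        rwa [wordInverts_wordSection, hw, if_pos rfl] at this
      have ht' : ((wordSection w false).map s).prod * (z.map s).prod ^ k = t⁻¹ := by
        have h0 := h.prod_mul w false
        rw [hw] at h0
        have hp := hsq.pow_right k
        rw [← pow_mul] at hp
        have hz' : (z.map s).prod ^ k = (x false)⁻¹ * (w.map s).prod ^ (2 * k) * x false := by
          rw [hp.eq]; group
        have hs' : ((wordSection w false).map s).prod =
            (x true)⁻¹ * ((w.map s).prod * x false) := by
          rw [h0]; simp
        rw [hk, pow_succ'] at hwn
        calc _ = (x true)⁻¹ * ((w.map s).prod * (w.map s).prod ^ (2 * k)) * x false := by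
              rw [hz', hs']; group
          _ = t⁻¹ := by rw [hwn, ht]; group
      have hinv := hu.mul_left hzk
      rw [ht'] at hinv
      have hc : SemiconjBy t⁻¹ (t ^ 2) (t ^ 2) := ((Commute.refl t).pow_right 2).inv_left
      have := hinv.eq.symm.trans hc.eq
      rw [mul_left_inj, inv_eq_iff_mul_eq_one, ← pow_add] at this
      exact this

end Relations

/-! ### The action on the free group on the two letters -/

/-- The permutation of pairs (output, state) that reads the letter `y` backwards. -/
def readBack (y : Bool) : Equiv.Perm (FreeGroup Bool × Fin 3) where
  toFun p := (p.1 * (FreeGroup.of (flips ((next y).symm p.2) ^^ y))⁻¹, (next y).symm p.2)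
  invFun p := (p.1 * FreeGroup.of (flips p.2 ^^ y), next y p.2)
  left_inv p := by simp
  right_inv p := by simp

/-- The pair (output, state) reached from `p` after reading `g`. -/
def read (g : FreeGroup Bool) (p : FreeGroup Bool × Fin 3) : FreeGroup Bool × Fin 3 :=
  (FreeGroup.lift readBack g)⁻¹ p

/-- The action of a state on the free group on the letters. -/
def act (i : Fin 3) (g : FreeGroup Bool) : FreeGroup Bool := (read g (1, i)).1

theorem read_mul_left (g h k : FreeGroup Bool) (i : Fin 3) :
    read g (h * k, i) = (h * (read g (k, i)).1, (read g (k, i)).2) := by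
  let L : Equiv.Perm (FreeGroup Bool × Fin 3) := (Equiv.mulLeft h).prodCongr (Equiv.refl _)
  have hL : Commute (FreeGroup.lift readBack g) L := by
    induction g using FreeGroup.induction_on with
    | C1 => simp
    | of y =>
      rw [FreeGroup.lift_apply_of]
      ext p : 1
      simp [L, readBack, mul_assoc]
    | inv_of y hy => rw [map_inv]; exact hy.inv_left
    | mul g₁ g₂ h₁ h₂ => rw [map_mul]; exact h₁.mul_left h₂
  exact DFunLike.congr_fun hL.inv_left.eq (k, i)

theorem act_one (i : Fin 3) : act i 1 = 1 := by simp [act, read]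

theorem act_of_mul (i : Fin 3) (y : Bool) (g : FreeGroup Bool) :
    act i (FreeGroup.of y * g) = FreeGroup.of (flips i ^^ y) * act (next y i) g := by
  have h : act i (FreeGroup.of y * g) =
      (read g (FreeGroup.of (flips i ^^ y) * 1, next y i)).1 := by
    simp only [act, read, map_mul, mul_inv_rev, FreeGroup.lift_apply_of, Equiv.Perm.mul_apply]
    congr 2
  rw [h, read_mul_left, act]

theorem act_of_inv_mul (i : Fin 3) (y : Bool) (g : FreeGroup Bool) :
    act (next y i) ((FreeGroup.of y)⁻¹ * g) = (FreeGroup.of (flips i ^^ y))⁻¹ * act i g := by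
  rw [eq_inv_mul_iff_mul_eq, ← act_of_mul, mul_inv_cancel_left]

/-- The automorphism of the free group exchanging the two letters. -/
def swapLetters : FreeGroup Bool ≃* FreeGroup Bool :=
  FreeGroup.freeGroupCongr Equiv.boolNot

theorem swapLetters_of (y : Bool) : swapLetters (FreeGroup.of y) = FreeGroup.of (!y) := by
  simp [swapLetters]

theorem swapLetters_swapLetters (g : FreeGroup Bool) : swapLetters (swapLetters g) = g := by
  have : swapLetters.toMonoidHom.comp swapLetters.toMonoidHom = MonoidHom.id _ := by
    ext y
    simp [swapLetters_of]
  exact DFunLike.congr_fun this g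

theorem act_swapLetters_act (i : Fin 3) (g : FreeGroup Bool) :
    act i (swapLetters (act i g)) = swapLetters g := by
  have hf : ∀ i y, (flips i ^^ !(flips i ^^ y)) = !y := by decide
  have hn : ∀ i y, next (!(flips i ^^ y)) i = next y i := by decide
  have hg : g ∈ Subgroup.closure (Set.range (FreeGroup.of (α := Bool))) := by
    rw [FreeGroup.closure_range_of]; trivial
  induction hg using Subgroup.closure_induction_left generalizing i with
  | one => simp [act_one]
  | mul_left y hy g hg ih =>
    obtain ⟨y, rfl⟩ := hy
    rw [act_of_mul, map_mul, swapLetters_of, act_of_mul, hf, hn, ih, map_mul, swapLetters_of]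
  | inv_mul_cancel y hy g hg ih =>
    obtain ⟨y, rfl⟩ := hy
    obtain ⟨j, rfl⟩ := (next y).surjective i
    rw [act_of_inv_mul, map_mul, map_inv, swapLetters_of, ← hn j y, act_of_inv_mul, hf, ih,
      map_mul, map_inv, swapLetters_of]

/-- The permutation of the free group on the letters given by a state. -/
def actPerm (i : Fin 3) : Equiv.Perm (FreeGroup Bool) where
  toFun := act i
  invFun g := swapLetters (act i (swapLetters g))
  left_inv g := by dsimp only; rw [act_swapLetters_act, swapLetters_swapLetters]
  right_inv g := by dsimp only; rw [act_swapLetters_act, swapLetters_swapLetters]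

theorem squareRelations_actPerm :
    SquareRelations actPerm fun y => MulAction.toPerm (FreeGroup.of y) := by
  intro i y
  ext g : 1
  exact act_of_mul i y g

/-! ### The group of the Wise complex -/

theorem squareRelations_GW : SquareRelations ![a, b, c] fun y => bif y then v else u := by
  have h (i j k l : Fin 5) (hr : FreeGroup.of i * FreeGroup.of j * (FreeGroup.of k)⁻¹ *
      (FreeGroup.of l)⁻¹ ∈ relsW) : (PresentedGroup.of i * PresentedGroup.of j : GW) =
      PresentedGroup.of l * PresentedGroup.of k := by
    have := PresentedGroup.one_of_mem hr
    rwa [map_mul, map_mul, map_mul, map_inv, map_inv, mul_inv_eq_one, mul_inv_eq_iff_eq_mul]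
      at this
  rw [squareRelations_iff]
  exact ⟨h 0 3 1 3 (by simp [relsW]), h 0 4 1 4 (by simp [relsW]), h 1 3 0 4 (by simp [relsW]),
    h 1 4 2 3 (by simp [relsW]), h 2 3 2 4 (by simp [relsW]), h 2 4 0 3 (by simp [relsW])⟩

/-- The homomorphism from `G_W` given by elements satisfying the square relations. -/
def liftGW {G : Type*} [Group G] {s : Fin 3 → G} {x : Bool → G} (h : SquareRelations s x) :
    GW →* G :=
  PresentedGroup.toGroup (f := ![s 0, s 1, s 2, x false, x true]) (by
    obtain ⟨h1, h2, h3, h4, h5, h6⟩ := (squareRelations_iff s x).1 h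
    rintro r (rfl | rfl | rfl | rfl | rfl | rfl) <;>
      simp [h1, h2, h3, h4, h5, h6])

theorem pow_four_ne_one : (u⁻¹ * v) ^ 4 ≠ 1 := by
  intro h
  have hu : liftGW squareRelations_actPerm u = MulAction.toPerm (FreeGroup.of false) := by
    simp [liftGW, u]
  have hv : liftGW squareRelations_actPerm v = MulAction.toPerm (FreeGroup.of true) := by
    simp [liftGW, v]
  have h1 := congrArg (liftGW squareRelations_actPerm) h
  rw [map_pow, map_mul, map_inv, hu, hv, map_one] at h1
  have h2 := DFunLike.congr_fun h1 (1 : FreeGroup Bool)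
  have h3 : ((FreeGroup.of false)⁻¹ * FreeGroup.of true) ^ 4 = (1 : FreeGroup Bool) := by
    simpa [pow_succ, mul_assoc] using h2
  revert h3
  decide

end WiseComplex

open WiseComplex in
/-- The element `(u⁻¹v)⁴` of `G_W` is nontrivial and lies in every finite-index
subgroup; in particular `G_W` is not residually finite. -/
theorem wise_not_residuallyFinite :
    (u⁻¹ * v) ^ 4 ≠ 1 ∧
    (∀ H : Subgroup GW, H.FiniteIndex → (u⁻¹ * v) ^ 4 ∈ H) ∧
    ¬ (∀ g : GW, g ≠ 1 → ∃ N : Subgroup GW, N.Normal ∧ N.FiniteIndex ∧ g ∉ N) := by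
  have hmem : ∀ H : Subgroup GW, H.FiniteIndex → (u⁻¹ * v) ^ 4 ∈ H := by
    intro H hH
    refine H.normalCore_le ?_
    let q := QuotientGroup.mk' H.normalCore
    have hq : SquareRelations (q ∘ ![a, b, c]) (q ∘ fun y => bif y then v else u) := by
      intro i y
      simpa using congrArg q (squareRelations_GW i y)
    have := hq.pow_four_eq_one (Nat.card (GW ⧸ H.normalCore)) Nat.card_pos [1] rfl pow_card_eq_one'
    rw [← QuotientGroup.ker_mk' H.normalCore, MonoidHom.mem_ker]
    rw [map_pow, map_mul, map_inv]
    exact this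
  refine ⟨pow_four_ne_one, hmem, fun h => ?_⟩
  obtain ⟨N, -, hN, hg⟩ := h _ pow_four_ne_one
  exact hg (hmem N hN)
end
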